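/- arXiv:1302.2357 — 6 statements merged into one kernel-verified Lean document; each statement's English description precedes it below -/
import Mathlib

section
/- For every real t > 1, the double series Σ_{i,j≥1} (φ(i)/i^{1+t}) · (φ(j)/j^{1+t}) · gcd(i,j) converges and equals ζ(2t−1) · Π_p (1 + 2/p^t − 2/p^{t+1} − 1/p^{2t+1}), where the product runs over all primes p; equivalently, it equals ζ(2t−1)·ζ(t)² · Π_p (1 − 2/p^{t+1} − 3/p^{2t} + 3/p^{2t+1} + 2/p^{3t} − 1/p^{4t+1}). -/
/-- The Riemann zeta function on the real axis, `ζ(s) = Σ_{k≥1} 1/k^s` (for `s > 1`). -/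
noncomputable def zetaReal (s : ℝ) : ℝ := ∑' k : ℕ+, 1 / (k : ℝ) ^ s

open Finset in
lemma HasSum.sum_divisors {f : ℕ → ℕ → ℝ} {a : ℝ} (hf : HasSum (fun x : ℕ × ℕ => f x.1 x.2) a)
    (hl : ∀ n, f 0 n = 0) (hr : ∀ n, f n 0 = 0) :
    HasSum (fun n => ∑ d ∈ n.divisors, f d (n / d)) a := by
  convert! hf.tsum_fiberwise (fun x => x.1 * x.2) using 1
  funext n
  rw [← Nat.sum_divisorsAntidiagonal f]
  rcases eq_or_ne n 0 with rfl | hn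
  · rw [Nat.divisorsAntidiagonal_zero, sum_empty, eq_comm]
    convert tsum_zero with x
    rcases mul_eq_zero.mp (show x.1.1 * x.1.2 = 0 from x.2) with h | h <;> simp [h, hl, hr]
  · have : (fun x : ℕ × ℕ => x.1 * x.2) ⁻¹' {n} = ↑n.divisorsAntidiagonal := by
      ext x; simp [hn]
    rw [this]
    exact (Finset.tsum_subtype' n.divisorsAntidiagonal fun x : ℕ × ℕ => f x.1 x.2).symm

open Finset in
lemma Summable.tsum_sum_range {f : ℕ → ℕ → ℝ} (hf : Summable (fun x : ℕ × ℕ => f x.1 x.2)) :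
    ∑' n, ∑ k ∈ range (n + 1), f k (n - k) = ∑' x : ℕ × ℕ, f x.1 x.2 := by
  rw [← (hf.hasSum.tsum_fiberwise (fun x => x.1 + x.2)).tsum_eq]
  refine tsum_congr fun n => ?_
  rw [← Finset.Nat.sum_antidiagonal_eq_sum_range_succ f]
  have : (fun x : ℕ × ℕ => x.1 + x.2) ⁻¹' {n} = ↑(antidiagonal n) := by
    ext x; simp
  rw [this]
  exact (Finset.tsum_subtype' (antidiagonal n) fun x : ℕ × ℕ => f x.1 x.2).symm

open Finset in
lemma Nat.Coprime.sum_divisors_mul_of_mul {f : ℕ → ℕ → ℝ}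
    (hmul : ∀ {a b c d : ℕ}, Nat.Coprime (a * b) (c * d) → f (a * c) (b * d) = f a b * f c d)
    {m n : ℕ} (hmn : m.Coprime n) :
    ∑ d ∈ (m * n).divisors, f d (m * n / d) =
      (∑ d ∈ m.divisors, f d (m / d)) * ∑ d ∈ n.divisors, f d (n / d) := by
  rw [Nat.divisors_mul, Finset.mul_def, Finset.sum_image hmn.mul_injOn_divisors, sum_mul_sum,
    ← sum_product']
  refine sum_congr rfl fun x hx => ?_
  simp only [mem_product, Nat.mem_divisors] at hx
  rw [Nat.mul_div_mul_comm hx.1.1 hx.2.1]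
  exact hmul (by rwa [Nat.mul_div_cancel' hx.1.1, Nat.mul_div_cancel' hx.2.1])

/-- The Euler product of a multiplicative function of two variables. -/
theorem hasProd_tsum_prime_pow_pair {f : ℕ → ℕ → ℝ} (h1 : f 1 1 = 1)
    (hmul : ∀ {a b c d : ℕ}, Nat.Coprime (a * b) (c * d) → f (a * c) (b * d) = f a b * f c d)
    (hl : ∀ n, f 0 n = 0) (hr : ∀ n, f n 0 = 0)
    (hf : Summable (fun x : ℕ × ℕ => f x.1 x.2)) :
    HasProd (fun p : Nat.Primes => ∑' k : ℕ × ℕ, f ((p : ℕ) ^ k.1) ((p : ℕ) ^ k.2))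
      (∑' x : ℕ × ℕ, f x.1 x.2) := by
  have hsum : Summable (fun n => ‖∑ d ∈ n.divisors, f d (n / d)‖) :=
    .of_nonneg_of_le (fun _ => norm_nonneg _) (fun _ => norm_sum_le _ _)
      (hf.norm.hasSum.sum_divisors (f := fun a b => ‖f a b‖) (by simpa) (by simpa)).summable
  have key := EulerProduct.eulerProduct_hasProd (f := fun n => ∑ d ∈ n.divisors, f d (n / d))
    (by simp [h1]) (fun h => h.sum_divisors_mul_of_mul hmul) hsum (by simp)
  rw [(hf.hasSum.sum_divisors hl hr).tsum_eq] at key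
  convert! key using 1
  funext p
  have hinj := Nat.pow_right_injective p.2.two_le
  rw [← Summable.tsum_sum_range (f := fun k l => f ((p : ℕ) ^ k) ((p : ℕ) ^ l))
    (hf.comp_injective (hinj.prodMap hinj))]
  refine tsum_congr fun n => ?_
  rw [Nat.sum_divisors_prime_pow p.2]
  refine Finset.sum_congr rfl fun k hk => ?_
  rw [Nat.pow_div (Finset.mem_range_succ_iff.mp hk) p.2.pos]

lemma Summable.tsum_prod_eq_zero_add {f : ℕ × ℕ → ℝ} (hf : Summable f) :
    ∑' k, f k = f (0, 0) + ∑' k, f (k + 1, 0) + ∑' l, f (0, l + 1)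
      + ∑' k : ℕ × ℕ, f (k.1 + 1, k.2 + 1) := by
  have hs : Summable fun k : ℕ × ℕ => f (k.1 + 1, k.2 + 1) :=
    hf.comp_injective (i := Prod.map (· + 1) (· + 1))
      ((add_left_injective 1).prodMap (add_left_injective 1))
  have h0 : Summable fun k : ℕ => f (k + 1, 0) :=
    hf.comp_injective (i := fun k : ℕ => (k + 1, 0)) fun a b h => by simpa using h
  rw [hf.tsum_prod, hf.prod.tsum_eq_zero_add, (hf.prod_factor 0).tsum_eq_zero_add, hs.tsum_prod]
  have (k : ℕ) : ∑' l, f (k + 1, l) = f (k + 1, 0) + ∑' l, f (k + 1, l + 1) :=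
    (hf.prod_factor (k + 1)).tsum_eq_zero_add
  simp_rw [this]
  rw [h0.tsum_add hs.prod]
  ring

lemma tsum_pow_succ_of_abs_lt_one {x : ℝ} (hx : |x| < 1) : ∑' k : ℕ, x ^ (k + 1) = x / (1 - x) := by
  simp_rw [pow_succ, tsum_mul_right, tsum_geometric_of_abs_lt_one hx]
  ring

lemma one_sub_mul_tsum_pow_mul_gcd {p : ℕ} {x : ℝ} (hx : |x| < 1)
    (hs : Summable fun k : ℕ × ℕ => x ^ k.1 * x ^ k.2 * (Nat.gcd (p ^ k.1) (p ^ k.2) : ℝ)) :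
    (1 - p * x ^ 2) * ∑' k : ℕ × ℕ, x ^ k.1 * x ^ k.2 * (Nat.gcd (p ^ k.1) (p ^ k.2) : ℝ) =
      (1 + x) / (1 - x) := by
  have h := hs.tsum_prod_eq_zero_add
  have hstep (k : ℕ × ℕ) : x ^ (k.1 + 1) * x ^ (k.2 + 1)
      * (Nat.gcd (p ^ (k.1 + 1)) (p ^ (k.2 + 1)) : ℝ) =
      p * x ^ 2 * (x ^ k.1 * x ^ k.2 * (Nat.gcd (p ^ k.1) (p ^ k.2) : ℝ)) := by
    rw [pow_succ p, pow_succ p, Nat.gcd_mul_right]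
    push_cast
    ring
  simp only [hstep, tsum_mul_left] at h
  simp [tsum_pow_succ_of_abs_lt_one hx] at h
  have : 1 - x ≠ 0 := by linarith [abs_lt.mp hx]
  rw [one_sub_mul, sub_eq_iff_eq_add]
  refine h.trans ?_
  field_simp
  ring

/-- The general term of the double series, as a function on `ℕ × ℕ`. -/
noncomputable def totientGcdTerm (t : ℝ) (i j : ℕ) : ℝ :=
  (Nat.totient i : ℝ) / (i : ℝ) ^ (1 + t) * ((Nat.totient j : ℝ) / (j : ℝ) ^ (1 + t))
    * (Nat.gcd i j : ℝ)

lemma totient_div_rpow_le (t : ℝ) (i : ℕ) :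
    (Nat.totient i : ℝ) / (i : ℝ) ^ (1 + t) ≤ 1 / (i : ℝ) ^ t := by
  rcases Nat.eq_zero_or_pos i with rfl | hi
  · simp; positivity
  · have hi' : (0 : ℝ) < i := by exact_mod_cast hi
    rw [Real.rpow_add hi', Real.rpow_one, div_le_div_iff₀ (by positivity) (by positivity), one_mul]
    gcongr
    exact_mod_cast Nat.totient_le i

lemma summable_totientGcdTerm {t : ℝ} (ht : 1 < t) :
    Summable fun x : ℕ × ℕ => totientGcdTerm t x.1 x.2 := by
  have h1 : Summable fun n : ℕ => 1 / (n : ℝ) ^ t := Real.summable_one_div_nat_rpow.mpr ht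
  have h2 : Summable fun n : ℕ => 1 / (n : ℝ) ^ (2 * t - 1) :=
    Real.summable_one_div_nat_rpow.mpr (by linarith)
  have h3 := h2.mul_of_nonneg (h1.mul_of_nonneg h1 (fun _ => by positivity) fun _ => by positivity)
    (fun _ => by positivity) fun _ => by dsimp only; positivity
  let e : ℕ × ℕ → ℕ × ℕ × ℕ := fun x => (x.1.gcd x.2, x.1 / x.1.gcd x.2, x.2 / x.1.gcd x.2)
  have he : Function.Injective e := by
    rintro ⟨a, b⟩ ⟨c, d⟩ h
    simp only [e, Prod.mk.injEq] at h
    obtain ⟨h, h', h''⟩ := h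
    refine Prod.ext ?_ ?_
    · calc a = a.gcd b * (a / a.gcd b) := (Nat.mul_div_cancel' (Nat.gcd_dvd_left a b)).symm
        _ = c.gcd d * (c / c.gcd d) := by rw [h', h]
        _ = c := Nat.mul_div_cancel' (Nat.gcd_dvd_left c d)
    · calc b = a.gcd b * (b / a.gcd b) := (Nat.mul_div_cancel' (Nat.gcd_dvd_right a b)).symm
        _ = c.gcd d * (d / c.gcd d) := by rw [h'', h]
        _ = d := Nat.mul_div_cancel' (Nat.gcd_dvd_right c d)
  refine .of_nonneg_of_le (fun _ => by unfold totientGcdTerm; positivity) ?_ (h3.comp_injective he)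
  rintro ⟨i, j⟩
  calc totientGcdTerm t i j ≤ 1 / (i : ℝ) ^ t * (1 / (j : ℝ) ^ t) * (Nat.gcd i j : ℝ) := by
        unfold totientGcdTerm
        exact mul_le_mul_of_nonneg_right (mul_le_mul (totient_div_rpow_le t i)
          (totient_div_rpow_le t j) (by positivity) (by positivity)) (by positivity)
    _ = _ := by
        dsimp only [e, Function.comp]
        rcases Nat.eq_zero_or_pos (i.gcd j) with h | h
        · have h0 : (0 : ℝ) ^ (2 * t - 1) = 0 := Real.zero_rpow (by linarith)
          simp [h, h0]
        · obtain ⟨g, a, b, hg, hab, rfl, rfl⟩ := Nat.exists_coprime' h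
          have hg0 : (0 : ℝ) < g := by exact_mod_cast hg
          rw [Nat.gcd_mul_right, hab.gcd_eq_one, one_mul, Nat.mul_div_cancel _ hg, Nat.mul_div_cancel _ hg]
          push_cast
          rw [Real.mul_rpow (by positivity) hg0.le, Real.mul_rpow (by positivity) hg0.le,
            Real.rpow_sub hg0, two_mul, Real.rpow_add hg0, Real.rpow_one]
          simp only [one_div, mul_inv, inv_div]
          ring

lemma totientGcdTerm_mul (t : ℝ) {a b c d : ℕ} (h : Nat.Coprime (a * b) (c * d)) :
    totientGcdTerm t (a * c) (b * d) = totientGcdTerm t a b * totientGcdTerm t c d := by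
  have hac : a.Coprime c := h.coprime_mul_right.coprime_mul_right_right
  have hbd : b.Coprime d := h.coprime_mul_left.coprime_mul_left_right
  have had : a.Coprime d := h.coprime_mul_right.coprime_mul_left_right
  have hbc : b.Coprime c := h.coprime_mul_left.coprime_mul_right_right
  have hg : (a * c).gcd (b * d) = a.gcd b * c.gcd d := by
    rw [Nat.Coprime.gcd_mul _ hbd, Nat.Coprime.gcd_mul_right_cancel _ hbc.symm,
      Nat.Coprime.gcd_mul_left_cancel _ had]
  unfold totientGcdTerm
  rw [hg, Nat.totient_mul hac, Nat.totient_mul hbd]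
  push_cast
  rw [Real.mul_rpow (by positivity) (by positivity), Real.mul_rpow (by positivity) (by positivity)]
  ring

lemma totient_prime_pow_succ_div_rpow {p : ℕ} (hp : p.Prime) (t : ℝ) (k : ℕ) :
    (Nat.totient (p ^ (k + 1)) : ℝ) / ((p ^ (k + 1) : ℕ) : ℝ) ^ (1 + t) =
      (1 - 1 / p) * (((p : ℝ) ^ t)⁻¹) ^ (k + 1) := by
  have hp0 : (0 : ℝ) < p := by exact_mod_cast hp.pos
  rw [Nat.totient_prime_pow_succ hp, Nat.cast_mul, Nat.cast_sub hp.one_le]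
  push_cast
  rw [Real.rpow_add (by positivity), Real.rpow_one, ← Real.rpow_pow_comm hp0.le, inv_pow]
  field_simp
  ring

lemma one_sub_mul_tsum_totientGcdTerm_prime_pow {p : ℕ} (hp : p.Prime) {t : ℝ} (ht : 1 < t) :
    (1 - p * (((p : ℝ) ^ t)⁻¹) ^ 2) * ∑' k : ℕ × ℕ, totientGcdTerm t (p ^ k.1) (p ^ k.2) =
      1 + 2 * ((p : ℝ) ^ t)⁻¹ - 2 * ((p : ℝ) ^ t)⁻¹ / p - (((p : ℝ) ^ t)⁻¹) ^ 2 / p := by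
  have hp1 : (1 : ℝ) < p := by exact_mod_cast hp.one_lt
  have ha := totient_prime_pow_succ_div_rpow hp t
  have hx : |((p : ℝ) ^ t)⁻¹| < 1 := by
    rw [abs_of_nonneg (by positivity)]
    exact inv_lt_one_of_one_lt₀ (Real.one_lt_rpow hp1 (by linarith))
  have hx0 : ((p : ℝ) ^ t)⁻¹ ≠ 0 := by positivity
  generalize ((p : ℝ) ^ t)⁻¹ = x at *
  have hinj := Nat.pow_right_injective hp.two_le
  have hs : Summable fun k : ℕ × ℕ => totientGcdTerm t (p ^ k.1) (p ^ k.2) := by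
    simpa only [Function.comp_def, Prod.map_fst, Prod.map_snd] using
      (summable_totientGcdTerm ht).comp_injective (hinj.prodMap hinj)
  have hstep (k : ℕ × ℕ) : totientGcdTerm t (p ^ (k.1 + 1)) (p ^ (k.2 + 1)) =
      (1 - 1 / p) ^ 2 * p * x ^ 2 * (x ^ k.1 * x ^ k.2 * (Nat.gcd (p ^ k.1) (p ^ k.2) : ℝ)) := by
    unfold totientGcdTerm
    rw [ha, ha, pow_succ p, pow_succ p, Nat.gcd_mul_right]
    push_cast
    ring
  have hq : (1 - 1 / p : ℝ) ≠ 0 := by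
    rw [sub_ne_zero, ne_comm, Ne, div_eq_one_iff_eq (by positivity)]; exact hp1.ne
  have hs' : Summable fun k : ℕ × ℕ => x ^ k.1 * x ^ k.2 * (Nat.gcd (p ^ k.1) (p ^ k.2) : ℝ) := by
    have h := hs.comp_injective (i := Prod.map (· + 1) (· + 1))
      ((add_left_injective 1).prodMap (add_left_injective 1))
    simp only [Function.comp_def, Prod.map_fst, Prod.map_snd, hstep] at h
    exact (summable_mul_left_iff (by positivity)).mp h
  have hV := one_sub_mul_tsum_pow_mul_gcd hx hs'
  rw [hs.tsum_prod_eq_zero_add]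
  simp only [hstep, tsum_mul_left]
  have hl (k : ℕ) : totientGcdTerm t (p ^ (k + 1)) (p ^ 0) = (1 - 1 / p) * x ^ (k + 1) := by
    unfold totientGcdTerm; rw [ha]; simp
  have hr (k : ℕ) : totientGcdTerm t (p ^ 0) (p ^ (k + 1)) = (1 - 1 / p) * x ^ (k + 1) := by
    unfold totientGcdTerm; rw [ha]; simp
  have h00 : totientGcdTerm t (p ^ 0) (p ^ 0) = 1 := by simp [totientGcdTerm]
  simp only [hl, hr, h00, tsum_mul_left, tsum_pow_succ_of_abs_lt_one hx]
  rw [mul_add, ← mul_assoc, mul_comm (1 - _ : ℝ) (_ * x ^ 2), mul_assoc, hV]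
  have : 1 - x ≠ 0 := by linarith [abs_lt.mp hx]
  field_simp
  ring

lemma zetaReal_eq_tsum_nat {s : ℝ} (hs : 1 < s) : zetaReal s = ∑' n : ℕ, ((n : ℝ) ^ s)⁻¹ := by
  unfold zetaReal
  simp_rw [one_div]
  exact tsum_pnat_eq_tsum_of_eq_zero (f := fun n : ℕ => ((n : ℝ) ^ s)⁻¹)
    (by simp [Real.zero_rpow (by linarith : s ≠ 0)])

lemma zetaReal_pos {s : ℝ} (hs : 1 < s) : 0 < zetaReal s := by
  rw [zetaReal_eq_tsum_nat hs]
  exact (Real.summable_nat_rpow_inv.mpr hs).tsum_pos (fun _ => by positivity) 1 (by simp)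

lemma hasProd_one_sub_rpow_inv {s : ℝ} (hs : 1 < s) :
    HasProd (fun p : Nat.Primes => 1 - (((p : ℕ) : ℝ) ^ s)⁻¹) (zetaReal s)⁻¹ := by
  let f : ℕ →*₀ ℝ :=
    { toFun n := ((n : ℝ) ^ s)⁻¹
      map_zero' := by simp [Real.zero_rpow (by linarith : s ≠ 0)]
      map_one' := by simp
      map_mul' m n := by
        push_cast
        rw [Real.mul_rpow (by positivity) (by positivity), mul_inv] }
  have h := EulerProduct.eulerProduct_completely_multiplicative_hasProd (f := f)
    (Real.summable_nat_rpow_inv.mpr hs).norm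
  have hz : ∑' n, f n = zetaReal s := (zetaReal_eq_tsum_nat hs).symm
  rw [hz] at h
  have h' := h.inv₀ (zetaReal_pos hs).ne'
  simp only [inv_inv] at h'
  exact h'

/-- For every real `t > 1`, the double series
`Σ_{i,j≥1} (φ(i)/i^{1+t})(φ(j)/j^{1+t}) gcd(i,j)` converges and equals
`ζ(2t−1) Π_p (1 + 2/p^t − 2/p^{t+1} − 1/p^{2t+1})`; equivalently, it equals
`ζ(2t−1) ζ(t)² Π_p (1 − 2/p^{t+1} − 3/p^{2t} + 3/p^{2t+1} + 2/p^{3t} − 1/p^{4t+1})`. -/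
theorem double_sum_totient_gcd (t : ℝ) (ht : 1 < t) :
    Summable (fun p : ℕ+ × ℕ+ =>
      (Nat.totient p.1 : ℝ) / (p.1 : ℝ) ^ (1 + t) *
        ((Nat.totient p.2 : ℝ) / (p.2 : ℝ) ^ (1 + t)) * (Nat.gcd p.1 p.2 : ℝ)) ∧
    (∑' p : ℕ+ × ℕ+,
        (Nat.totient p.1 : ℝ) / (p.1 : ℝ) ^ (1 + t) *
          ((Nat.totient p.2 : ℝ) / (p.2 : ℝ) ^ (1 + t)) * (Nat.gcd p.1 p.2 : ℝ)) =
      zetaReal (2 * t - 1) *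
        ∏' p : Nat.Primes,
          (1 + 2 / ((p : ℕ) : ℝ) ^ t - 2 / ((p : ℕ) : ℝ) ^ (t + 1)
            - 1 / ((p : ℕ) : ℝ) ^ (2 * t + 1)) ∧
    (∑' p : ℕ+ × ℕ+,
        (Nat.totient p.1 : ℝ) / (p.1 : ℝ) ^ (1 + t) *
          ((Nat.totient p.2 : ℝ) / (p.2 : ℝ) ^ (1 + t)) * (Nat.gcd p.1 p.2 : ℝ)) =
      zetaReal (2 * t - 1) * zetaReal t ^ 2 *
        ∏' p : Nat.Primes,
          (1 - 2 / ((p : ℕ) : ℝ) ^ (t + 1) - 3 / ((p : ℕ) : ℝ) ^ (2 * t)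
            + 3 / ((p : ℕ) : ℝ) ^ (2 * t + 1) + 2 / ((p : ℕ) : ℝ) ^ (3 * t)
            - 1 / ((p : ℕ) : ℝ) ^ (4 * t + 1)) := by
  have hinj : Function.Injective (Prod.map ((↑) : ℕ+ → ℕ) ((↑) : ℕ+ → ℕ)) :=
    PNat.coe_injective.prodMap PNat.coe_injective
  have hl (n : ℕ) : totientGcdTerm t 0 n = 0 := by simp [totientGcdTerm]
  have hr (n : ℕ) : totientGcdTerm t n 0 = 0 := by simp [totientGcdTerm]
  have hs := summable_totientGcdTerm ht
  have htsum : (∑' p : ℕ+ × ℕ+,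
        (Nat.totient p.1 : ℝ) / (p.1 : ℝ) ^ (1 + t) *
          ((Nat.totient p.2 : ℝ) / (p.2 : ℝ) ^ (1 + t)) * (Nat.gcd p.1 p.2 : ℝ)) =
      ∑' x : ℕ × ℕ, totientGcdTerm t x.1 x.2 := by
    refine hinj.tsum_eq (f := fun x : ℕ × ℕ => totientGcdTerm t x.1 x.2) ?_
    rintro ⟨i, j⟩ h
    have hi : i ≠ 0 := by rintro rfl; exact h (hl j)
    have hj : j ≠ 0 := by rintro rfl; exact h (hr i)
    exact ⟨(⟨i, Nat.pos_of_ne_zero hi⟩, ⟨j, Nat.pos_of_ne_zero hj⟩), rfl⟩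
  have hprod := (hasProd_one_sub_rpow_inv (s := 2 * t - 1) (by linarith)).mul
    (hasProd_tsum_prime_pow_pair (f := totientGcdTerm t) (by simp [totientGcdTerm])
      (totientGcdTerm_mul t) hl hr hs)
  have hζ := (zetaReal_pos (s := 2 * t - 1) (by linarith)).ne'
  have hζt := (zetaReal_pos ht).ne'
  have hpow (p : Nat.Primes) : ((p : ℕ) : ℝ) ^ (t + 1) = ((p : ℕ) : ℝ) ^ t * (p : ℕ) ∧
      ((p : ℕ) : ℝ) ^ (2 * t) = (((p : ℕ) : ℝ) ^ t) ^ 2 ∧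
      ((p : ℕ) : ℝ) ^ (2 * t + 1) = (((p : ℕ) : ℝ) ^ t) ^ 2 * (p : ℕ) ∧
      ((p : ℕ) : ℝ) ^ (3 * t) = (((p : ℕ) : ℝ) ^ t) ^ 3 ∧
      ((p : ℕ) : ℝ) ^ (4 * t + 1) = (((p : ℕ) : ℝ) ^ t) ^ 4 * (p : ℕ) ∧
      ((p : ℕ) : ℝ) ^ (2 * t - 1) = (((p : ℕ) : ℝ) ^ t) ^ 2 / (p : ℕ) := by
    have hp : (0 : ℝ) < (p : ℕ) := by exact_mod_cast p.2.pos
    have hk (k : ℕ) : ((p : ℕ) : ℝ) ^ (k * t) = (((p : ℕ) : ℝ) ^ t) ^ k := by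
      rw [mul_comm, Real.rpow_mul_natCast hp.le]
    have h2 := hk 2
    have h3 := hk 3
    have h4 := hk 4
    push_cast at h2 h3 h4
    simp only [Real.rpow_add hp, Real.rpow_sub hp, Real.rpow_one, h2, h3, h4, and_self]
  have hfirst : HasProd (fun p : Nat.Primes =>
      1 + 2 / ((p : ℕ) : ℝ) ^ t - 2 / ((p : ℕ) : ℝ) ^ (t + 1)
        - 1 / ((p : ℕ) : ℝ) ^ (2 * t + 1))
      ((zetaReal (2 * t - 1))⁻¹ * ∑' x : ℕ × ℕ, totientGcdTerm t x.1 x.2) := by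
    convert! hprod using 1
    funext p
    obtain ⟨h1, -, h3, -, -, h6⟩ := hpow p
    have h := one_sub_mul_tsum_totientGcdTerm_prime_pow p.2 ht
    rw [h1, h3, h6, inv_div, div_eq_mul_inv (p : ℝ), ← inv_pow, h]
    ring
  have hsecond : HasProd (fun p : Nat.Primes =>
      1 - 2 / ((p : ℕ) : ℝ) ^ (t + 1) - 3 / ((p : ℕ) : ℝ) ^ (2 * t)
        + 3 / ((p : ℕ) : ℝ) ^ (2 * t + 1) + 2 / ((p : ℕ) : ℝ) ^ (3 * t)
        - 1 / ((p : ℕ) : ℝ) ^ (4 * t + 1))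
      ((zetaReal (2 * t - 1))⁻¹ * (∑' x : ℕ × ℕ, totientGcdTerm t x.1 x.2)
        * ((zetaReal t)⁻¹ * (zetaReal t)⁻¹)) := by
    have hζp := hasProd_one_sub_rpow_inv ht
    convert! hfirst.mul (hζp.mul hζp) using 1
    funext p
    obtain ⟨h1, h2, h3, h4, h5, -⟩ := hpow p
    rw [h1, h2, h3, h4, h5]
    ring
  refine ⟨?_, ?_, ?_⟩
  · simpa only [Function.comp_def, Prod.map_fst, Prod.map_snd, totientGcdTerm] using
      hs.comp_injective hinj
  · rw [htsum, hfirst.tprod_eq, mul_inv_cancel_left₀ hζ]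
  · rw [htsum, hsecond.tprod_eq]
    field_simp
end

section
/- Let Δ = (1/12) · Π_p (1 − 5/p² + 5/p³ − 1/p⁵), the product over all primes p. Then, as N → ∞, Σ_{i·j ≤ N} (φ(i)/i²)·(φ(j)/j²)·gcd(i,j) ∼ Δ·(ln N)³, where the sum runs over all pairs of positive integers i, j with i·j ≤ N. In particular, liminf_{N→∞} (ln N)^{-3} · Σ_{lcm(i,j) ≤ N} (φ(i)/i²)·(φ(j)/j²)·gcd(i,j) ≥ Δ. -/
open Filter

/-- The constant `Δ = (1/12) Π_p (1 − 5/p² + 5/p³ − 1/p⁵)`. -/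
noncomputable def DeltaConst : ℝ :=
  (1 / 12) * ∏' p : Nat.Primes,
    (1 - 5 / ((p : ℕ) : ℝ) ^ 2 + 5 / ((p : ℕ) : ℝ) ^ 3 - 1 / ((p : ℕ) : ℝ) ^ 5)

/-- The function supported on squarefree `n` with value `∏ p ∣ n, g p` there. -/
noncomputable def sqfreeProd (g : ℕ → ℝ) (n : ℕ) : ℝ :=
  if Squarefree n then ∏ p ∈ n.primeFactors, g p else 0

lemma sum_divisors_sqfreeProd (g : ℕ → ℝ) {n : ℕ} (hn : n ≠ 0) :
    ∑ d ∈ n.divisors, sqfreeProd g d = ∏ p ∈ n.primeFactors, (1 + g p) := by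
  unfold sqfreeProd
  rw [← Finset.sum_filter, Nat.sum_divisors_filter_squarefree hn, Finset.prod_one_add,
    Nat.factors_eq]
  refine Finset.sum_congr rfl fun t ht => ?_
  rw [Finset.prod_val, Function.id_def, Nat.primeFactors_prod]
  intro p hp
  exact Nat.prime_of_mem_primeFactors (Finset.mem_powerset.mp ht hp)

lemma sqfreeProd_one (g : ℕ → ℝ) : sqfreeProd g 1 = 1 := by simp [sqfreeProd]

lemma sqfreeProd_zero (g : ℕ → ℝ) : sqfreeProd g 0 = 0 := by simp [sqfreeProd]

lemma sqfreeProd_mul (g : ℕ → ℝ) {m n : ℕ} (h : m.Coprime n) :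
    sqfreeProd g (m * n) = sqfreeProd g m * sqfreeProd g n := by
  unfold sqfreeProd
  simp only [Nat.squarefree_mul h, h.primeFactors_mul, Finset.prod_union h.disjoint_primeFactors]
  split_ifs <;> simp_all

lemma abs_sqfreeProd_le {g : ℕ → ℝ}
    (hg : ∀ p : ℕ, p.Prime → |g p| ≤ (p : ℝ) ^ (-(1 / 4) : ℝ)) (n : ℕ) :
    |sqfreeProd g n| ≤ (n : ℝ) ^ (-(1 / 4) : ℝ) := by
  unfold sqfreeProd
  split_ifs with h
  · nth_rw 2 [← Nat.prod_primeFactors_of_squarefree h]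
    push_cast
    rw [Finset.abs_prod, ← Real.finsetProd_rpow _ _ (fun i _ => Nat.cast_nonneg i)]
    exact Finset.prod_le_prod (fun _ _ => abs_nonneg _)
      fun p hp => hg p (Nat.prime_of_mem_primeFactors hp)
  · rw [abs_zero]; positivity

lemma one_add_log_le {n : ℕ} (hn : n ≠ 0) : 1 + Real.log n ≤ 8 * (n : ℝ) ^ (1 / 8 : ℝ) := by
  have hn' : (0 : ℝ) < n := by positivity
  have h := Real.log_le_sub_one_of_pos (Real.rpow_pos_of_pos hn' (1 / 8))
  rw [Real.log_rpow hn'] at h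
  linarith

lemma abs_sqfreeProd_div_mul_le {g : ℕ → ℝ}
    (hg : ∀ p : ℕ, p.Prime → |g p| ≤ (p : ℝ) ^ (-(1 / 4) : ℝ)) (n : ℕ) :
    |sqfreeProd g n / n| * (1 + Real.log n) ≤ 8 * (n : ℝ) ^ (-(9 / 8) : ℝ) := by
  rcases eq_or_ne n 0 with rfl | hn
  · simp [sqfreeProd_zero]
  have hn' : (0 : ℝ) < n := by positivity
  rw [abs_div, abs_of_pos hn']
  calc |sqfreeProd g n| / n * (1 + Real.log n)
      ≤ (n : ℝ) ^ (-(1 / 4) : ℝ) / n * (8 * (n : ℝ) ^ (1 / 8 : ℝ)) := by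
        have := Real.log_natCast_nonneg n
        gcongr
        · exact abs_sqfreeProd_le hg n
        · exact one_add_log_le hn
    _ = 8 * ((n : ℝ) ^ (-(1 / 4) : ℝ) * (n : ℝ) ^ (1 / 8 : ℝ) * (n : ℝ) ^ (-1 : ℝ)) := by
        rw [Real.rpow_neg_one]; ring
    _ = 8 * (n : ℝ) ^ (-(9 / 8) : ℝ) := by
        rw [← Real.rpow_add hn', ← Real.rpow_add hn']; norm_num

/-- A uniform bound for the error terms in logarithmic means of `∏ p ∣ n, (1 + g p)`. -/
noncomputable def meanBound : ℝ := ∑' n : ℕ, 8 * (n : ℝ) ^ (-(9 / 8) : ℝ)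

lemma summable_meanBound : Summable fun n : ℕ => 8 * (n : ℝ) ^ (-(9 / 8) : ℝ) :=
  (Real.summable_nat_rpow.mpr (by norm_num)).mul_left 8

lemma meanBound_nonneg : 0 ≤ meanBound := tsum_nonneg fun n => by positivity

lemma abs_sqfreeProd_div_le {g : ℕ → ℝ}
    (hg : ∀ p : ℕ, p.Prime → |g p| ≤ (p : ℝ) ^ (-(1 / 4) : ℝ)) (n : ℕ) :
    |sqfreeProd g n / n| ≤ 8 * (n : ℝ) ^ (-(9 / 8) : ℝ) := by
  refine le_trans ?_ (abs_sqfreeProd_div_mul_le hg n)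
  have := Real.log_natCast_nonneg n
  exact le_mul_of_one_le_right (abs_nonneg _) (by linarith)

lemma summable_sqfreeProd_div {g : ℕ → ℝ}
    (hg : ∀ p : ℕ, p.Prime → |g p| ≤ (p : ℝ) ^ (-(1 / 4) : ℝ)) :
    Summable fun n : ℕ => ‖sqfreeProd g n / n‖ :=
  summable_meanBound.of_nonneg_of_le (fun _ => norm_nonneg _) (abs_sqfreeProd_div_le hg)

/-- The logarithmic mean value of `n ↦ ∏ p ∣ n, (1 + g p)`. -/
noncomputable def logMean (g : ℕ → ℝ) : ℝ := ∑' n : ℕ, sqfreeProd g n / n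

lemma abs_logMean_le {g : ℕ → ℝ}
    (hg : ∀ p : ℕ, p.Prime → |g p| ≤ (p : ℝ) ^ (-(1 / 4) : ℝ)) : |logMean g| ≤ meanBound := by
  rw [← Real.norm_eq_abs]
  exact tsum_of_norm_bounded summable_meanBound.hasSum (abs_sqfreeProd_div_le hg)

lemma hasProd_logMean {g : ℕ → ℝ}
    (hg : ∀ p : ℕ, p.Prime → |g p| ≤ (p : ℝ) ^ (-(1 / 4) : ℝ)) :
    HasProd (fun p : Nat.Primes => 1 + g p / (p : ℕ)) (logMean g) := by
  have h := EulerProduct.eulerProduct_hasProd (f := fun n : ℕ => sqfreeProd g n / n)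
    (by simp [sqfreeProd_one])
    (fun {m n} hmn => by rw [sqfreeProd_mul g hmn]; push_cast; rw [mul_div_mul_comm])
    (summable_sqfreeProd_div hg) (by simp)
  convert! h using 2 with p
  rw [tsum_eq_sum (s := {0, 1})]
  · rw [Finset.sum_pair zero_ne_one]
    simp [sqfreeProd, p.2.prime.squarefree, p.2.primeFactors]
  · intro e he
    simp only [Finset.mem_insert, Finset.mem_singleton, not_or] at he
    have : ¬ Squarefree ((p : ℕ) ^ e) := by
      rw [Nat.squarefree_pow_iff p.2.ne_one he.1]
      tauto
    simp [sqfreeProd, this]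

lemma abs_sum_inv_sub_log_le {x : ℝ} (hx : 1 ≤ x) {e : ℕ} (he : e ≠ 0) :
    |∑ m ∈ Finset.Ioc 0 (⌊x⌋₊ / e), (m : ℝ)⁻¹ - Real.log x| ≤ 1 + Real.log e := by
  have he' : (0 : ℝ) < e := by positivity
  have hle := Real.log_natCast_nonneg e
  rw [← Nat.floor_div_natCast]
  have hh : ∑ m ∈ Finset.Ioc 0 ⌊x / e⌋₊, (m : ℝ)⁻¹ = (harmonic ⌊x / e⌋₊ : ℝ) := by
    rw [harmonic_eq_sum_Icc]; push_cast; rfl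
  have hlog : Real.log (x / e) = Real.log x - Real.log e := Real.log_div (by positivity) he'.ne'
  rcases lt_or_ge (x / e) 1 with h | h
  · rw [Nat.floor_eq_zero.mpr h]
    have h1 : Real.log (x / e) ≤ 0 := Real.log_nonpos (by positivity) h.le
    have := Real.log_nonneg hx
    simp only [Finset.Ioc_self, Finset.sum_empty, zero_sub, abs_neg]
    rw [abs_of_nonneg this]
    linarith
  · have h1 := log_le_harmonic_floor (x / e) (by positivity)
    have h2 := harmonic_floor_le_one_add_log (x / e) h
    rw [hh, abs_le]
    constructor <;> linarith

lemma abs_sum_sub_logMean_le {g : ℕ → ℝ}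
    (hg : ∀ p : ℕ, p.Prime → |g p| ≤ (p : ℝ) ^ (-(1 / 4) : ℝ)) {x : ℝ} (hx : 1 ≤ x) :
    |∑ n ∈ Finset.Ioc 0 ⌊x⌋₊, (∏ p ∈ n.primeFactors, (1 + g p)) / n - logMean g * Real.log x|
      ≤ meanBound := by
  let u : ArithmeticFunction ℝ := ⟨fun n => sqfreeProd g n / n, by simp⟩
  let v : ArithmeticFunction ℝ := ⟨fun n => (n : ℝ)⁻¹, by simp⟩
  have h1 : ∑ n ∈ Finset.Ioc 0 ⌊x⌋₊, (∏ p ∈ n.primeFactors, (1 + g p)) / n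
      = ∑ e ∈ Finset.Ioc 0 ⌊x⌋₊,
          sqfreeProd g e / e * ∑ m ∈ Finset.Ioc 0 (⌊x⌋₊ / e), (m : ℝ)⁻¹ := by
    refine Eq.trans ?_ (ArithmeticFunction.sum_Ioc_mul_eq_sum_sum u v ⌊x⌋₊)
    refine Finset.sum_congr rfl fun n hn => ?_
    have hn0 : n ≠ 0 := by simp at hn; omega
    rw [← sum_divisors_sqfreeProd g hn0, ArithmeticFunction.mul_apply,
      ← Nat.sum_divisorsAntidiagonal (fun d _ => sqfreeProd g d), Finset.sum_div]
    refine Finset.sum_congr rfl fun y hy => ?_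
    have := (Nat.mem_divisorsAntidiagonal.mp hy).1
    simp only [u, v, ArithmeticFunction.coe_mk, ← this]
    push_cast
    rw [div_mul_eq_div_div, div_eq_mul_inv _ (y.2 : ℝ)]
  have h2 : ∑ e ∈ Finset.Ioc 0 ⌊x⌋₊,
          sqfreeProd g e / e * ∑ m ∈ Finset.Ioc 0 (⌊x⌋₊ / e), (m : ℝ)⁻¹
      = ∑' e : ℕ, sqfreeProd g e / e * ∑ m ∈ Finset.Ioc 0 (⌊x⌋₊ / e), (m : ℝ)⁻¹ := by
    rw [tsum_eq_sum]
    intro e he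
    simp only [Finset.mem_Ioc, not_and_or, not_lt, not_le, Nat.le_zero] at he
    rcases he with rfl | he
    · simp
    · simp [Nat.div_eq_of_lt he]
  have hs : Summable fun e : ℕ =>
      sqfreeProd g e / e * ∑ m ∈ Finset.Ioc 0 (⌊x⌋₊ / e), (m : ℝ)⁻¹ := by
    refine summable_of_ne_finset_zero (s := Finset.Ioc 0 ⌊x⌋₊) ?_
    intro e he
    simp only [Finset.mem_Ioc, not_and_or, not_lt, not_le, Nat.le_zero] at he
    rcases he with rfl | he
    · simp
    · simp [Nat.div_eq_of_lt he]
  rw [h1, h2, logMean, ← tsum_mul_right,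
    ← hs.tsum_sub ((summable_sqfreeProd_div hg).of_norm.mul_right _)]
  rw [← Real.norm_eq_abs]
  refine tsum_of_norm_bounded summable_meanBound.hasSum fun e => ?_
  rcases eq_or_ne e 0 with rfl | he
  · simp
  rw [← mul_sub, Real.norm_eq_abs, abs_mul]
  exact (mul_le_mul_of_nonneg_left (abs_sum_inv_sub_log_le hx he) (abs_nonneg _)).trans
    (abs_sqfreeProd_div_mul_le hg e)

lemma abs_sum_mul_log_pow_sub_le {a : ℕ → ℝ} (ha : a 0 = 0) {c C : ℝ}
    (h : ∀ t : ℝ, 1 ≤ t → |∑ n ∈ Finset.Ioc 0 ⌊t⌋₊, a n - c * Real.log t| ≤ C)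
    (k : ℕ) {x : ℝ} (hx : 1 ≤ x) :
    |∑ n ∈ Finset.Ioc 0 ⌊x⌋₊, a n * Real.log (x / n) ^ (k + 1)
        - c * (Real.log x ^ (k + 2) / (k + 2))| ≤ C * Real.log x ^ (k + 1) := by
  set L := Real.log x with hL
  let f : ℝ → ℝ := fun t => (L - Real.log t) ^ (k + 1)
  let D : ℝ → ℝ := fun t => (k + 1) * (L - Real.log t) ^ k / t
  have hf : ∀ t ∈ Set.Icc 1 x, HasDerivAt f (-D t) t := by
    intro t ht
    have ht0 : t ≠ 0 := by linarith [ht.1]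
    have := ((Real.hasDerivAt_log ht0).const_sub L).fun_pow (k + 1)
    refine this.congr_deriv ?_
    simp only [D, Nat.add_sub_cancel]
    push_cast
    field_simp
  have hDc : ContinuousOn D (Set.Icc 1 x) := by
    have h0 : ∀ t ∈ Set.Icc 1 x, t ≠ 0 := fun t ht => by linarith [ht.1]
    have : ContinuousOn Real.log (Set.Icc 1 x) := Real.continuousOn_log.mono h0
    exact (continuousOn_const.mul ((continuousOn_const.sub this).pow k)).div continuousOn_id h0
  have hDi : IntervalIntegrable D MeasureTheory.volume 1 x := by
    apply ContinuousOn.intervalIntegrable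
    rwa [Set.uIcc_of_le hx]
  have hlc : ContinuousOn (fun t => D t * Real.log t) (Set.Icc 1 x) :=
    hDc.mul (Real.continuousOn_log.mono fun t ht => by
      have := ht.1; simp; linarith)
  have hli : IntervalIntegrable (fun t => D t * Real.log t) MeasureTheory.volume 1 x := by
    apply ContinuousOn.intervalIntegrable
    rwa [Set.uIcc_of_le hx]
  have hderiv : ∀ t ∈ Set.Icc 1 x, deriv f t = -D t := fun t ht => (hf t ht).deriv
  have hint : MeasureTheory.IntegrableOn (deriv f) (Set.Icc 1 x) :=
    (hDc.neg.integrableOn_Icc).congr_fun (fun t ht => (hderiv t ht).symm) measurableSet_Icc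
  have hIcc : ∀ n : ℕ, ∑ i ∈ Finset.Icc 0 n, a i = ∑ i ∈ Finset.Ioc 0 n, a i := by
    intro n
    rw [Finset.Icc_eq_cons_Ioc (Nat.zero_le _), Finset.sum_cons, ha, zero_add]
  have hsum : ∑ n ∈ Finset.Ioc 0 ⌊x⌋₊, a n * Real.log (x / n) ^ (k + 1)
      = ∫ t in (1 : ℝ)..x, D t * ∑ n ∈ Finset.Ioc 0 ⌊t⌋₊, a n := by
    have key := sum_mul_eq_sub_integral_mul₀ a ha x (fun t ht => (hf t ht).differentiableAt) hint
    rw [Finset.Icc_eq_cons_Ioc (Nat.zero_le _), Finset.sum_cons, ha, mul_zero, zero_add] at key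
    have hfx : f x = 0 := by simp [f, hL]
    rw [hfx, zero_mul, zero_sub, ← MeasureTheory.integral_neg] at key
    rw [intervalIntegral.integral_of_le hx]
    refine Eq.trans (Finset.sum_congr rfl fun n hn => ?_) (key.trans ?_)
    · have hn0 : (n : ℝ) ≠ 0 := by
        have := (Finset.mem_Ioc.mp hn).1
        positivity
      rw [Real.log_div (by positivity) hn0, mul_comm]
    · refine MeasureTheory.setIntegral_congr_fun measurableSet_Ioc fun t ht => ?_
      simp only [hIcc, hderiv t (Set.Ioc_subset_Icc_self ht)]
      ring
  have hi1 : ∫ t in (1 : ℝ)..x, D t = L ^ (k + 1) := by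
    have := intervalIntegral.integral_eq_sub_of_hasDerivAt (f := fun t => -f t) (f' := D)
      (a := 1) (b := x) (fun t ht => by
        rw [Set.uIcc_of_le hx] at ht
        simpa using (hf t ht).fun_neg) hDi
    rw [this]
    simp [f, hL]
  have hi2 : ∫ t in (1 : ℝ)..x, D t * Real.log t = L ^ (k + 2) / (k + 2) := by
    have := intervalIntegral.integral_eq_sub_of_hasDerivAt
      (f := fun t => -(L - Real.log t) ^ (k + 1) * Real.log t
        - (L - Real.log t) ^ (k + 2) / (k + 2))
      (f' := fun t => D t * Real.log t) (a := 1) (b := x) (fun t ht => by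
        rw [Set.uIcc_of_le hx] at ht
        have ht0 : t ≠ 0 := by linarith [ht.1]
        have h2 := (((Real.hasDerivAt_log ht0).const_sub L).fun_pow (k + 2)).div_const ((k : ℝ) + 2)
        have h1 := ((hf t ht).fun_neg.fun_mul (Real.hasDerivAt_log ht0)).fun_sub h2
        convert h1 using 1
        simp only [f]
        push_cast
        have : (k : ℝ) + 2 ≠ 0 := by positivity
        field_simp
        ring) hli
    rw [this]
    simp [hL]
  have hSi : IntervalIntegrable (fun t => D t * ∑ n ∈ Finset.Ioc 0 ⌊t⌋₊, a n)
      MeasureTheory.volume 1 x := by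
    have := integrableOn_mul_sum_Icc a (m := 0) zero_le_one hDc.integrableOn_Icc
    simp only [hIcc] at this
    exact (intervalIntegrable_iff_integrableOn_Ioc_of_le hx).mpr
      (this.mono_set Set.Ioc_subset_Icc_self)
  rw [hsum, ← hi1, ← hi2, ← intervalIntegral.integral_const_mul,
    ← intervalIntegral.integral_const_mul, ← intervalIntegral.integral_sub hSi (hli.const_mul c),
    ← Real.norm_eq_abs]
  refine intervalIntegral.norm_integral_le_of_norm_le hx ?_ (hDi.const_mul C)
  refine MeasureTheory.ae_of_all _ fun t ht => ?_
  have hD0 : 0 ≤ D t := by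
    have h1 := ht.1
    have : Real.log t ≤ L := Real.log_le_log (by linarith) ht.2
    have : 0 ≤ L - Real.log t := by linarith
    simp only [D]
    positivity
  rw [show D t * ∑ n ∈ Finset.Ioc 0 ⌊t⌋₊, a n - c * (D t * Real.log t)
    = D t * (∑ n ∈ Finset.Ioc 0 ⌊t⌋₊, a n - c * Real.log t) by ring, norm_mul,
    Real.norm_of_nonneg hD0, mul_comm C]
  exact mul_le_mul_of_nonneg_left (h t ht.1.le) hD0

lemma sum_Ioc_inv_le {x : ℝ} (hx : 1 ≤ x) :
    ∑ n ∈ Finset.Ioc 0 ⌊x⌋₊, (n : ℝ)⁻¹ ≤ 1 + Real.log x := by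
  refine le_trans (le_of_eq ?_) (harmonic_floor_le_one_add_log x hx)
  rw [harmonic_eq_sum_Icc]
  push_cast
  rfl

lemma abs_double_sum_sub_le {g : ℕ → ℝ}
    (hg : ∀ p : ℕ, p.Prime → |g p| ≤ (p : ℝ) ^ (-(1 / 4) : ℝ))
    (h0 : ∀ p : ℕ, p.Prime → 0 ≤ 1 + g p) (h1 : ∀ p : ℕ, p.Prime → 1 + g p ≤ 1)
    {x : ℝ} (hx : 1 ≤ x) :
    |∑ n ∈ Finset.Ioc 0 ⌊x⌋₊, (∏ p ∈ n.primeFactors, (1 + g p)) / n *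
        ∑ m ∈ Finset.Ioc 0 ⌊x / n⌋₊, (∏ p ∈ m.primeFactors, (1 + g p)) / m
      - logMean g ^ 2 * (Real.log x ^ 2 / 2)| ≤ (meanBound + meanBound ^ 2) * (1 + Real.log x) := by
  set a : ℕ → ℝ := fun n => (∏ p ∈ n.primeFactors, (1 + g p)) / n with ha
  have hM := meanBound_nonneg
  have hL := Real.log_nonneg hx
  have ha0 : ∀ n, |a n| ≤ (n : ℝ)⁻¹ := by
    intro n
    have hp : ∀ p ∈ n.primeFactors, p.Prime := fun p hp => Nat.prime_of_mem_primeFactors hp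
    rw [ha, abs_of_nonneg (div_nonneg (Finset.prod_nonneg fun p h => h0 p (hp p h))
      (Nat.cast_nonneg n)), ← one_div]
    gcongr
    exact Finset.prod_le_one (fun p h => h0 p (hp p h)) fun p h => h1 p (hp p h)
  have hk := abs_sum_mul_log_pow_sub_le (a := a) (by simp [ha])
    (fun t ht => abs_sum_sub_logMean_le hg ht) 0 hx
  have hsplit : ∑ n ∈ Finset.Ioc 0 ⌊x⌋₊, a n * ∑ m ∈ Finset.Ioc 0 ⌊x / n⌋₊, a m
      - logMean g ^ 2 * (Real.log x ^ 2 / 2)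
      = ∑ n ∈ Finset.Ioc 0 ⌊x⌋₊, a n * (∑ m ∈ Finset.Ioc 0 ⌊x / n⌋₊, a m
          - logMean g * Real.log (x / n))
        + logMean g * (∑ n ∈ Finset.Ioc 0 ⌊x⌋₊, a n * Real.log (x / n) ^ (0 + 1)
          - logMean g * (Real.log x ^ (0 + 2) / ((0 : ℕ) + 2))) := by
    simp only [mul_sub, Finset.sum_sub_distrib, Finset.mul_sum]
    norm_num
    rw [show ∑ i ∈ Finset.Ioc 0 ⌊x⌋₊, a i * (logMean g * Real.log (x / i))
      = ∑ i ∈ Finset.Ioc 0 ⌊x⌋₊, logMean g * (a i * Real.log (x / i)) from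
      Finset.sum_congr rfl fun _ _ => by ring]
    ring
  rw [hsplit]
  have e1 : |∑ n ∈ Finset.Ioc 0 ⌊x⌋₊, a n * (∑ m ∈ Finset.Ioc 0 ⌊x / n⌋₊, a m
          - logMean g * Real.log (x / n))| ≤ meanBound * (1 + Real.log x) := by
    refine (Finset.abs_sum_le_sum_abs _ _).trans ?_
    calc _ ≤ ∑ n ∈ Finset.Ioc 0 ⌊x⌋₊, (n : ℝ)⁻¹ * meanBound := by
          refine Finset.sum_le_sum fun n hn => ?_
          rw [abs_mul]
          have hn' := Finset.mem_Ioc.mp hn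
          have hnx : (n : ℝ) ≤ x := (Nat.le_floor_iff (by linarith)).mp hn'.2
          have hn0 : (0 : ℝ) < n := by exact_mod_cast hn'.1
          exact mul_le_mul (ha0 n)
            (abs_sum_sub_logMean_le hg ((one_le_div hn0).mpr hnx)) (abs_nonneg _) (by positivity)
      _ ≤ (1 + Real.log x) * meanBound := by
          rw [← Finset.sum_mul]
          exact mul_le_mul_of_nonneg_right (sum_Ioc_inv_le hx) hM
      _ = _ := mul_comm _ _
  have e2 := mul_le_mul (abs_logMean_le hg) hk (abs_nonneg _) hM
  rw [← abs_mul] at e2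
  refine (abs_add_le _ _).trans ((add_le_add e1 e2).trans ?_)
  rw [zero_add, pow_one]
  nlinarith [sq_nonneg meanBound]

/-- The local factors `g p` with `1 + g p = 1 - 1 / p` for `p ∤ d`, and `1 + g p = 1` otherwise. -/
noncomputable def awayFactor (d p : ℕ) : ℝ := if p ∣ d then 0 else -(p : ℝ)⁻¹

lemma inv_prime_le_half {p : ℕ} (hp : p.Prime) : (p : ℝ)⁻¹ ≤ 1 / 2 := by
  rw [inv_eq_one_div]
  have : (2 : ℝ) ≤ p := by exact_mod_cast hp.two_le
  gcongr

lemma abs_awayFactor_le (d : ℕ) {p : ℕ} (hp : p.Prime) :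
    |awayFactor d p| ≤ (p : ℝ) ^ (-(1 / 4) : ℝ) := by
  unfold awayFactor
  split_ifs
  · rw [abs_zero]; positivity
  · rw [abs_neg, abs_of_nonneg (by positivity), ← Real.rpow_neg_one]
    exact Real.rpow_le_rpow_of_exponent_le (by exact_mod_cast hp.one_le) (by norm_num)

lemma one_add_awayFactor_nonneg (d : ℕ) {p : ℕ} (hp : p.Prime) : 0 ≤ 1 + awayFactor d p := by
  unfold awayFactor
  have := inv_prime_le_half hp
  split_ifs <;> linarith

lemma one_add_awayFactor_le_one (d : ℕ) {p : ℕ} : 1 + awayFactor d p ≤ 1 := by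
  unfold awayFactor
  have : (0 : ℝ) ≤ (p : ℝ)⁻¹ := by positivity
  split_ifs <;> linarith

lemma totient_div_eq_prod {n : ℕ} (hn : n ≠ 0) :
    (Nat.totient n : ℝ) / n = ∏ p ∈ n.primeFactors, (1 - (p : ℝ)⁻¹) := by
  have h : (Nat.totient n : ℝ) = n * ∏ p ∈ n.primeFactors, (1 - (p : ℝ)⁻¹) := by
    have := congrArg (Rat.cast : ℚ → ℝ) (Nat.totient_eq_mul_prod_factors n)
    push_cast at this
    exact this
  rw [h]
  field_simp

lemma totient_mul_div_eq {d a : ℕ} (hd : d ≠ 0) (ha : a ≠ 0) :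
    (Nat.totient (d * a) : ℝ) / (d * a : ℕ)
      = (Nat.totient d : ℝ) / d * ∏ p ∈ a.primeFactors, (1 + awayFactor d p) := by
  rw [totient_div_eq_prod (mul_ne_zero hd ha), totient_div_eq_prod hd,
    Nat.primeFactors_mul hd ha, ← Finset.union_sdiff_self_eq_union,
    Finset.prod_union Finset.disjoint_sdiff]
  congr 1
  rw [Finset.sdiff_eq_filter, Finset.prod_filter]
  refine Finset.prod_congr rfl fun p hp => ?_
  have : p ∈ d.primeFactors ↔ p ∣ d := by
    simp [Nat.prime_of_mem_primeFactors hp, hd]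
  simp only [awayFactor, this]
  split_ifs <;> ring

lemma sum_gcd_eq (N : ℕ) :
    ∑ p ∈ (Finset.Icc 1 N ×ˢ Finset.Icc 1 N).filter (fun p => p.1 * p.2 ≤ N),
        (Nat.totient p.1 : ℝ) / (p.1 : ℝ) ^ 2 * ((Nat.totient p.2 : ℝ) / (p.2 : ℝ) ^ 2) *
          (Nat.gcd p.1 p.2 : ℝ)
      = ∑ d ∈ Finset.Ioc 0 N.sqrt, ((Nat.totient d : ℝ) / d) ^ 3 / d *
          ∑ n ∈ Finset.Ioc 0 (N / d ^ 2), (∏ p ∈ n.primeFactors, (1 + awayFactor d p)) / n *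
            ∑ m ∈ Finset.Ioc 0 (N / d ^ 2 / n),
              (∏ p ∈ m.primeFactors, (1 + awayFactor d p)) / m := by
  set P := (Finset.Icc 1 N ×ˢ Finset.Icc 1 N).filter (fun p => p.1 * p.2 ≤ N) with hP
  have h1 : ∀ p ∈ P, (Nat.gcd p.1 p.2 : ℝ)
      = ∑ d ∈ Finset.Ioc 0 N.sqrt, if d ∣ p.1 ∧ d ∣ p.2 then (Nat.totient d : ℝ) else 0 := by
    intro p hp
    simp only [hP, Finset.mem_filter, Finset.mem_product, Finset.mem_Icc] at hp
    obtain ⟨⟨⟨hi, -⟩, hj, -⟩, hN⟩ := hp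
    rw [← Finset.sum_filter]
    conv_lhs => rw [← Nat.sum_totient (Nat.gcd p.1 p.2)]
    push_cast
    refine Finset.sum_congr ?_ fun _ _ => rfl
    ext d
    simp only [Nat.mem_divisors, Nat.dvd_gcd_iff, Finset.mem_filter, Finset.mem_Ioc, Nat.le_sqrt]
    constructor
    · rintro ⟨⟨h1, h2⟩, -⟩
      exact ⟨⟨Nat.pos_of_dvd_of_pos h1 hi,
        (Nat.mul_le_mul (Nat.le_of_dvd hi h1) (Nat.le_of_dvd hj h2)).trans hN⟩, h1, h2⟩
    · rintro ⟨-, h⟩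
      exact ⟨h, (Nat.gcd_pos_of_pos_left _ hi).ne'⟩
  rw [Finset.sum_congr rfl fun p hp => by rw [h1 p hp, Finset.mul_sum], Finset.sum_comm]
  refine Finset.sum_congr rfl fun d hd => ?_
  have hd0 : 0 < d := (Finset.mem_Ioc.mp hd).1
  have hdr : (d : ℝ) ≠ 0 := by positivity
  simp only [mul_ite, mul_zero]
  rw [← Finset.sum_filter]
  simp only [Finset.mul_sum]
  rw [Finset.sum_sigma']
  refine Finset.sum_nbij' (fun p => ⟨p.1 / d, p.2 / d⟩) (fun s => (d * s.1, d * s.2)) ?_ ?_ ?_ ?_ ?_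
  · rintro ⟨i, j⟩ hp
    simp only [hP, Finset.mem_filter, Finset.mem_product, Finset.mem_Icc] at hp
    obtain ⟨⟨⟨⟨hi, -⟩, hj, -⟩, hN⟩, ⟨n, rfl⟩, ⟨m, rfl⟩⟩ := hp
    have hn : 0 < n := Nat.pos_of_mul_pos_left hi
    have hm : 0 < m := Nat.pos_of_mul_pos_left hj
    simp only [Finset.mem_sigma, Finset.mem_Ioc, Nat.mul_div_cancel_left _ hd0]
    have hN' : m * n * d ^ 2 ≤ N := by nlinarith
    refine ⟨⟨hn, (Nat.le_div_iff_mul_le (by positivity)).mpr ?_⟩, hm,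
      (Nat.le_div_iff_mul_le hn).mpr ((Nat.le_div_iff_mul_le (by positivity)).mpr hN')⟩
    exact le_trans (Nat.mul_le_mul_right _ (Nat.le_mul_of_pos_left n hm)) hN'
  · rintro ⟨n, m⟩ hs
    simp only [Finset.mem_sigma, Finset.mem_Ioc] at hs
    obtain ⟨⟨hn, -⟩, hm, hs⟩ := hs
    rw [Nat.le_div_iff_mul_le hn, Nat.le_div_iff_mul_le (by positivity)] at hs
    simp only [hP, Finset.mem_filter, Finset.mem_product, Finset.mem_Icc]
    have h1 : 0 < d * n := by positivity
    have h2 : 0 < d * m := by positivity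
    have hN : d * n * (d * m) ≤ N := by nlinarith
    exact ⟨⟨⟨⟨h1, (Nat.le_mul_of_pos_right _ h2).trans hN⟩, h2,
      (Nat.le_mul_of_pos_left _ h1).trans hN⟩, hN⟩, dvd_mul_right _ _, dvd_mul_right _ _⟩
  · rintro ⟨i, j⟩ hp
    simp only [Finset.mem_filter] at hp
    simp only [Nat.mul_div_cancel' hp.2.1, Nat.mul_div_cancel' hp.2.2]
  · rintro ⟨n, m⟩ -
    simp only [Nat.mul_div_cancel_left _ hd0]
  · rintro ⟨i, j⟩ hp
    simp only [hP, Finset.mem_filter, Finset.mem_product, Finset.mem_Icc] at hp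
    obtain ⟨⟨⟨⟨hi, -⟩, hj, -⟩, hN⟩, ⟨n, rfl⟩, ⟨m, rfl⟩⟩ := hp
    have hn : 0 < n := Nat.pos_of_mul_pos_left hi
    have hm : 0 < m := Nat.pos_of_mul_pos_left hj
    simp only [Nat.mul_div_cancel_left _ hd0]
    have key : ∀ a : ℕ, 0 < a → (Nat.totient (d * a) : ℝ) / ((d * a : ℕ) : ℝ) ^ 2
        = (Nat.totient d : ℝ) / d * (∏ p ∈ a.primeFactors, (1 + awayFactor d p)) / (d * a) := by
      intro a ha
      rw [← totient_mul_div_eq hd0.ne' ha.ne', pow_two, div_div]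
      push_cast
      ring
    rw [key n hn, key m hm]
    have : (n : ℝ) ≠ 0 := by positivity
    have : (m : ℝ) ≠ 0 := by positivity
    field_simp

/-- The local factors `g p` with `1 + g p = (1 - 1 / p) / (1 + 1 / p) ^ 2`. -/
noncomputable def gcdFactor (p : ℕ) : ℝ := (1 - (p : ℝ)⁻¹) / (1 + (p : ℝ)⁻¹) ^ 2 - 1

lemma abs_gcdFactor_le {p : ℕ} (hp : p.Prime) :
    |gcdFactor p| ≤ (p : ℝ) ^ (-(1 / 4) : ℝ) := by
  have h2 := inv_prime_le_half hp
  have h0 : (0 : ℝ) ≤ (p : ℝ)⁻¹ := by positivity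
  have hr : ((p : ℝ) ^ (-(1 / 4) : ℝ)) ^ 4 = (p : ℝ)⁻¹ := by
    rw [← Real.rpow_natCast, ← Real.rpow_mul (Nat.cast_nonneg p), ← Real.rpow_neg_one]
    norm_num
  refine le_of_pow_le_pow_left₀ (n := 4) (by norm_num) (by positivity) ?_
  rw [hr]
  set x := (p : ℝ)⁻¹
  have hx : gcdFactor p = -(x * (3 + x) / (1 + x) ^ 2) := by
    simp only [gcdFactor]
    field_simp
    ring
  rw [hx, abs_neg, abs_of_nonneg (by positivity), div_pow, div_le_iff₀ (by positivity)]
  have h3 : x ^ 3 * (3 + x) ^ 4 ≤ ((1 + x) ^ 2) ^ 4 := by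
    have ha : x * (3 + x) ≤ 7 / 9 * (1 + x) ^ 2 := by nlinarith
    have hb : x * (3 + x) ^ 2 ≤ 81 / 49 * ((1 + x) ^ 2) ^ 2 := by
      nlinarith [pow_nonneg h0 3, pow_nonneg h0 4, sq_nonneg (x - 3 / 10)]
    calc x ^ 3 * (3 + x) ^ 4 = (x * (3 + x)) ^ 2 * (x * (3 + x) ^ 2) := by ring
      _ ≤ (7 / 9 * (1 + x) ^ 2) ^ 2 * (81 / 49 * ((1 + x) ^ 2) ^ 2) := by gcongr
      _ = ((1 + x) ^ 2) ^ 4 := by ring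
  nlinarith [mul_le_mul_of_nonneg_left h3 h0]

lemma logMean_awayFactor_mul {d : ℕ} (hd : d ≠ 0) :
    logMean (awayFactor d) * ∏ p ∈ d.primeFactors, (1 - (p : ℝ)⁻¹ ^ 2)
      = logMean (awayFactor 1) := by
  have h1 := hasProd_logMean fun p hp => abs_awayFactor_le d (p := p) hp
  have h2 : HasProd (fun p : Nat.Primes => if (p : ℕ) ∣ d then 1 - ((p : ℕ) : ℝ)⁻¹ ^ 2 else 1)
      (∏ p ∈ d.primeFactors, (1 - (p : ℝ)⁻¹ ^ 2)) := by
    have := hasProd_prod_of_ne_finset_one (L := SummationFilter.unconditional _)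
      (f := fun p : Nat.Primes => if (p : ℕ) ∣ d then 1 - ((p : ℕ) : ℝ)⁻¹ ^ 2 else 1)
      (s := d.primeFactors.subtype Nat.Prime) (fun p hp =>
        if_neg fun h => hp (Finset.mem_subtype.mpr (Nat.mem_primeFactors.mpr ⟨p.2, h, hd⟩)))
    convert! this using 1
    refine Eq.trans ?_ (Finset.prod_subtype_of_mem
      (fun p : ℕ => if p ∣ d then 1 - (p : ℝ)⁻¹ ^ 2 else 1)
      fun p hp => Nat.prime_of_mem_primeFactors hp).symm
    exact Finset.prod_congr rfl fun p hp => (if_pos (Nat.dvd_of_mem_primeFactors hp)).symm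
  refine (h1.mul h2).unique ?_
  convert! hasProd_logMean fun p hp => abs_awayFactor_le 1 (p := p) hp using 2 with p
  have : ¬ (p : ℕ) ∣ 1 := p.2.one_lt.not_ge ∘ Nat.le_of_dvd one_pos
  rw [awayFactor, awayFactor, if_neg this]
  split_ifs <;> ring

lemma totient_div_pow_three_mul_logMean_sq {d : ℕ} (hd : d ≠ 0) :
    ((Nat.totient d : ℝ) / d) ^ 3 * logMean (awayFactor d) ^ 2
      = logMean (awayFactor 1) ^ 2 * ∏ p ∈ d.primeFactors, (1 + gcdFactor p) := by
  rw [← logMean_awayFactor_mul hd, totient_div_eq_prod hd, mul_pow, mul_assoc, ← Finset.prod_pow,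
    ← Finset.prod_pow, ← Finset.prod_mul_distrib, mul_comm]
  congr 1
  refine Finset.prod_congr rfl fun p _ => ?_
  have : (0 : ℝ) ≤ (p : ℝ)⁻¹ := by positivity
  rw [gcdFactor]
  set x := (p : ℝ)⁻¹
  field_simp
  ring

lemma logMean_sq_mul_logMean_gcdFactor :
    logMean (awayFactor 1) ^ 2 * logMean gcdFactor / 12 = DeltaConst := by
  have h1 := hasProd_logMean fun p hp => abs_awayFactor_le 1 (p := p) hp
  have h2 := hasProd_logMean fun p hp => abs_gcdFactor_le (p := p) hp
  rw [DeltaConst, pow_two, ← ((h1.mul h1).mul h2).tprod_eq, div_eq_inv_mul, one_div]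
  congr 1
  refine tprod_congr fun p => ?_
  have : ¬ (p : ℕ) ∣ 1 := p.2.one_lt.not_ge ∘ Nat.le_of_dvd one_pos
  have hp : (0 : ℝ) < (p : ℕ) := by exact_mod_cast p.2.pos
  rw [awayFactor, if_neg this, gcdFactor]
  field_simp
  ring

lemma DeltaConst_ne_zero : DeltaConst ≠ 0 := by
  have h := tprod_one_add_ne_zero_of_summable (ι := Nat.Primes) (R := ℝ)
    (f := fun p => -5 / ((p : ℕ) : ℝ) ^ 2 + 5 / ((p : ℕ) : ℝ) ^ 3 - 1 / ((p : ℕ) : ℝ) ^ 5)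
    (fun p => by
      have h2 := inv_prime_le_half p.2
      have h0 : (0 : ℝ) < ((p : ℕ) : ℝ)⁻¹ := by
        have := p.2.pos
        positivity
      set x := ((p : ℕ) : ℝ)⁻¹ with hx
      have : 1 + (-5 / ((p : ℕ) : ℝ) ^ 2 + 5 / ((p : ℕ) : ℝ) ^ 3 - 1 / ((p : ℕ) : ℝ) ^ 5)
          = (1 - x) ^ 3 * (1 + 3 * x + x ^ 2) := by
        simp only [div_eq_mul_inv, ← inv_pow, ← hx]
        ring
      rw [this]
      have : 0 < 1 - x := by linarith
      positivity)
    (by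
      have hs : Summable fun p : Nat.Primes => 11 * (1 / ((p : ℕ) : ℝ) ^ 2) :=
        ((Real.summable_one_div_nat_pow.mpr one_lt_two).comp_injective
          Subtype.val_injective).mul_left 11
      refine hs.of_nonneg_of_le (fun _ => norm_nonneg _) fun p => ?_
      have h2 := inv_prime_le_half p.2
      have h0 : (0 : ℝ) ≤ ((p : ℕ) : ℝ)⁻¹ := by positivity
      simp only [div_eq_mul_inv, ← inv_pow]
      set x := ((p : ℕ) : ℝ)⁻¹
      have h3 : x ^ 3 ≤ x ^ 2 := pow_le_pow_of_le_one h0 (by linarith) (by norm_num)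
      have h5 : x ^ 5 ≤ x ^ 2 := pow_le_pow_of_le_one h0 (by linarith) (by norm_num)
      have h3' : 0 ≤ x ^ 3 := by positivity
      have h5' : 0 ≤ x ^ 5 := by positivity
      rw [Real.norm_eq_abs, abs_le]
      constructor <;> linarith)
  rw [DeltaConst]
  refine mul_ne_zero (by norm_num) ?_
  convert! h using 3
  ring

lemma abs_sum_gcd_sub_le : ∃ K : ℝ, ∀ N : ℕ, 1 ≤ N →
    |∑ p ∈ (Finset.Icc 1 N ×ˢ Finset.Icc 1 N).filter (fun p => p.1 * p.2 ≤ N),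
        (Nat.totient p.1 : ℝ) / (p.1 : ℝ) ^ 2 * ((Nat.totient p.2 : ℝ) / (p.2 : ℝ) ^ 2) *
          (Nat.gcd p.1 p.2 : ℝ) - DeltaConst * Real.log N ^ 3|
      ≤ K * (1 + Real.log N) ^ 2 := by
  set Z := logMean (awayFactor 1) with hZ
  have hM := meanBound_nonneg
  refine ⟨meanBound + meanBound ^ 2 + 2 * Z ^ 2 * meanBound, fun N hN => ?_⟩
  have hN1 : (1 : ℝ) ≤ N := by exact_mod_cast hN
  have hL : 0 ≤ Real.log N := Real.log_nonneg hN1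
  have hy1 : 1 ≤ √(N : ℝ) := Real.one_le_sqrt.mpr hN1
  have hlogy : Real.log √(N : ℝ) = Real.log N / 2 := Real.log_sqrt (by positivity)
  have hsq : ⌊√(N : ℝ)⌋₊ = N.sqrt := Real.nat_floor_real_sqrt_eq_nat_sqrt
  set A : ℕ → ℝ := fun d =>
    ∑ n ∈ Finset.Ioc 0 (N / d ^ 2), (∏ p ∈ n.primeFactors, (1 + awayFactor d p)) / n *
      ∑ m ∈ Finset.Ioc 0 (N / d ^ 2 / n), (∏ p ∈ m.primeFactors, (1 + awayFactor d p)) / m with hA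
  rw [sum_gcd_eq]
  have hmem : ∀ d ∈ Finset.Ioc 0 N.sqrt, 0 < d ∧ d ^ 2 ≤ N := by
    intro d hd
    rw [Finset.mem_Ioc, Nat.le_sqrt'] at hd
    exact hd
  have hAd : ∀ d ∈ Finset.Ioc 0 N.sqrt,
      |A d - logMean (awayFactor d) ^ 2 * (2 * Real.log (√(N : ℝ) / d) ^ 2)|
        ≤ (meanBound + meanBound ^ 2) * (1 + Real.log N) := by
    intro d hd
    obtain ⟨hd0, hdN⟩ := hmem d hd
    have hd0' : (0 : ℝ) < d := by exact_mod_cast hd0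
    have hd1 : (1 : ℝ) ≤ d := by exact_mod_cast hd0
    have hx : 1 ≤ (N : ℝ) / (d : ℝ) ^ 2 := by
      rw [one_le_div (by positivity)]
      exact_mod_cast hdN
    have h := abs_double_sum_sub_le (fun p hp => abs_awayFactor_le d (p := p) hp)
      (fun p hp => one_add_awayFactor_nonneg d hp) (fun p _ => one_add_awayFactor_le_one d) hx
    have hfl : ⌊(N : ℝ) / (d : ℝ) ^ 2⌋₊ = N / d ^ 2 := by
      rw [← Nat.floor_div_eq_div (K := ℝ)]
      push_cast
      rfl
    simp only [Nat.floor_div_natCast, hfl] at h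
    have hlog : Real.log ((N : ℝ) / (d : ℝ) ^ 2) = 2 * Real.log (√(N : ℝ) / d) := by
      rw [Real.log_div (by positivity) (by positivity), Real.log_div (by positivity)
        (by positivity), hlogy, Real.log_pow]
      push_cast
      ring
    have hle : Real.log ((N : ℝ) / (d : ℝ) ^ 2) ≤ Real.log N := by
      refine Real.log_le_log (by positivity) (div_le_self (by positivity) ?_)
      exact one_le_pow₀ hd1
    rw [show 2 * Real.log (√(N : ℝ) / d) ^ 2 = Real.log ((N : ℝ) / (d : ℝ) ^ 2) ^ 2 / 2 by
      rw [hlog]; ring]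
    exact h.trans (by gcongr)
  have hsplit : ∑ d ∈ Finset.Ioc 0 N.sqrt, ((Nat.totient d : ℝ) / d) ^ 3 / d * A d
      - DeltaConst * Real.log N ^ 3
      = ∑ d ∈ Finset.Ioc 0 N.sqrt, ((Nat.totient d : ℝ) / d) ^ 3 / d *
          (A d - logMean (awayFactor d) ^ 2 * (2 * Real.log (√(N : ℝ) / d) ^ 2))
        + 2 * Z ^ 2 * (∑ d ∈ Finset.Ioc 0 ⌊√(N : ℝ)⌋₊,
            (∏ p ∈ d.primeFactors, (1 + gcdFactor p)) / d * Real.log (√(N : ℝ) / d) ^ (1 + 1)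
          - logMean gcdFactor * (Real.log √(N : ℝ) ^ (1 + 2) / ((1 : ℕ) + 2))) := by
    have h : ∀ d ∈ Finset.Ioc 0 N.sqrt, ((Nat.totient d : ℝ) / d) ^ 3 / d *
          (logMean (awayFactor d) ^ 2 * (2 * Real.log (√(N : ℝ) / d) ^ 2))
        = 2 * Z ^ 2 * ((∏ p ∈ d.primeFactors, (1 + gcdFactor p)) / d *
            Real.log (√(N : ℝ) / d) ^ 2) := by
      intro d hd
      have := totient_div_pow_three_mul_logMean_sq (hmem d hd).1.ne'
      rw [← hZ] at this
      linear_combination (2 * Real.log (√(N : ℝ) / d) ^ 2 / d) * this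
    simp only [mul_sub, Finset.sum_sub_distrib]
    rw [Finset.sum_congr rfl h, hsq, hlogy, ← logMean_sq_mul_logMean_gcdFactor, ← hZ,
      Finset.mul_sum]
    push_cast
    ring
  have e1 : |∑ d ∈ Finset.Ioc 0 N.sqrt, ((Nat.totient d : ℝ) / d) ^ 3 / d *
      (A d - logMean (awayFactor d) ^ 2 * (2 * Real.log (√(N : ℝ) / d) ^ 2))|
      ≤ (1 + Real.log N) * ((meanBound + meanBound ^ 2) * (1 + Real.log N)) := by
    refine (Finset.abs_sum_le_sum_abs _ _).trans ?_
    calc _ ≤ ∑ d ∈ Finset.Ioc 0 N.sqrt,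
          (d : ℝ)⁻¹ * ((meanBound + meanBound ^ 2) * (1 + Real.log N)) := by
          refine Finset.sum_le_sum fun d hd => ?_
          have hd0 : (0 : ℝ) < d := by exact_mod_cast (hmem d hd).1
          rw [abs_mul, abs_of_nonneg (by positivity)]
          refine mul_le_mul ?_ (hAd d hd) (abs_nonneg _) (by positivity)
          rw [← one_div]
          gcongr
          refine pow_le_one₀ (by positivity) ((div_le_one hd0).mpr ?_)
          exact_mod_cast Nat.totient_le d
      _ ≤ _ := by
          rw [← Finset.sum_mul, ← hsq]
          refine mul_le_mul_of_nonneg_right ((sum_Ioc_inv_le hy1).trans ?_) (by positivity)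
          rw [hlogy]
          linarith
  have e2 := abs_sum_mul_log_pow_sub_le
    (a := fun d => (∏ p ∈ d.primeFactors, (1 + gcdFactor p)) / d) (by simp)
    (fun t ht => abs_sum_sub_logMean_le (fun p hp => abs_gcdFactor_le (p := p) hp) ht) 1 hy1
  rw [hsplit]
  refine (abs_add_le _ _).trans ?_
  rw [abs_mul, abs_of_nonneg (show 0 ≤ 2 * Z ^ 2 by positivity)]
  have e3 := mul_le_mul_of_nonneg_left e2 (show 0 ≤ 2 * Z ^ 2 by positivity)
  refine (add_le_add e1 e3).trans ?_
  have e4 : Real.log √(N : ℝ) ^ (1 + 1) ≤ (1 + Real.log N) ^ 2 := by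
    rw [hlogy]
    gcongr
    linarith
  have e5 := mul_le_mul_of_nonneg_left e4 (show 0 ≤ 2 * Z ^ 2 * meanBound by positivity)
  linarith

lemma sum_lcm_le {N : ℕ} (hN : 1 ≤ N) :
    ∑ p ∈ (Finset.Icc 1 N ×ˢ Finset.Icc 1 N).filter (fun p => Nat.lcm p.1 p.2 ≤ N),
        (Nat.totient p.1 : ℝ) / (p.1 : ℝ) ^ 2 * ((Nat.totient p.2 : ℝ) / (p.2 : ℝ) ^ 2) *
          (Nat.gcd p.1 p.2 : ℝ) ≤ (1 + Real.log N) ^ 3 := by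
  have hN1 : (1 : ℝ) ≤ N := by exact_mod_cast hN
  have hH := sum_Ioc_inv_le hN1
  rw [Nat.floor_natCast] at hH
  have h0 : 0 ≤ ∑ n ∈ Finset.Ioc 0 N, (n : ℝ)⁻¹ := Finset.sum_nonneg fun _ _ => by positivity
  refine le_trans ?_ (pow_le_pow_left₀ h0 hH 3)
  set I := Finset.Ioc 0 N with hI
  have hcube : (∑ n ∈ I, (n : ℝ)⁻¹) ^ 3
      = ∑ t ∈ I ×ˢ I ×ˢ I, (t.1 : ℝ)⁻¹ * ((t.2.1 : ℝ)⁻¹ * (t.2.2 : ℝ)⁻¹) := by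
    rw [pow_three, Finset.sum_mul_sum, ← Finset.sum_product', Finset.sum_mul_sum,
      ← Finset.sum_product']
  set e : ℕ × ℕ → ℕ × ℕ × ℕ := fun p =>
    (Nat.gcd p.1 p.2, p.1 / Nat.gcd p.1 p.2, p.2 / Nat.gcd p.1 p.2) with he
  set Q := (Finset.Icc 1 N ×ˢ Finset.Icc 1 N).filter (fun p => Nat.lcm p.1 p.2 ≤ N) with hQ
  have hinj : Set.InjOn e Q := by
    rintro ⟨i, j⟩ - ⟨i', j'⟩ - h
    simp only [he, Prod.mk.injEq] at h
    obtain ⟨hg, h1, h2⟩ := h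
    have a1 := Nat.div_mul_cancel (Nat.gcd_dvd_left i j)
    have a2 := Nat.div_mul_cancel (Nat.gcd_dvd_right i j)
    have b1 := Nat.div_mul_cancel (Nat.gcd_dvd_left i' j')
    have b2 := Nat.div_mul_cancel (Nat.gcd_dvd_right i' j')
    rw [h1, hg, b1] at a1
    rw [h2, hg, b2] at a2
    rw [a1, a2]
  have hmaps : Q.image e ⊆ I ×ˢ I ×ˢ I := by
    rw [Finset.image_subset_iff]
    rintro ⟨i, j⟩ hp
    simp only [hQ, Finset.mem_filter, Finset.mem_product, Finset.mem_Icc] at hp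
    obtain ⟨⟨⟨hi, hiN⟩, hj, hjN⟩, -⟩ := hp
    have hg : 0 < Nat.gcd i j := Nat.gcd_pos_of_pos_left _ hi
    simp only [he, hI, Finset.mem_product, Finset.mem_Ioc]
    exact ⟨⟨hg, (Nat.gcd_le_left _ hi).trans hiN⟩,
      ⟨Nat.div_pos (Nat.gcd_le_left _ hi) hg, (Nat.div_le_self _ _).trans hiN⟩,
      Nat.div_pos (Nat.gcd_le_right _ hj) hg, (Nat.div_le_self _ _).trans hjN⟩
  rw [hcube]
  refine le_trans ?_ (Finset.sum_le_sum_of_subset_of_nonneg hmaps fun _ _ _ => by positivity)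
  rw [Finset.sum_image hinj]
  refine Finset.sum_le_sum fun p hp => ?_
  obtain ⟨i, j⟩ := p
  simp only [hQ, Finset.mem_filter, Finset.mem_product, Finset.mem_Icc] at hp
  obtain ⟨⟨⟨hi, -⟩, hj, -⟩, -⟩ := hp
  have hi0 : (0 : ℝ) < i := by exact_mod_cast hi
  have hj0 : (0 : ℝ) < j := by exact_mod_cast hj
  have hg : (0 : ℝ) < Nat.gcd i j := by exact_mod_cast Nat.gcd_pos_of_pos_left _ hi
  simp only [he]
  rw [Nat.cast_div (Nat.gcd_dvd_left i j) hg.ne', Nat.cast_div (Nat.gcd_dvd_right i j) hg.ne']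
  calc _ ≤ (i : ℝ) / (i : ℝ) ^ 2 * ((j : ℝ) / (j : ℝ) ^ 2) * (Nat.gcd i j : ℝ) := by
        gcongr <;> exact_mod_cast Nat.totient_le _
    _ = _ := by field_simp

/-- As `N → ∞`, `Σ_{i·j ≤ N} (φ(i)/i²)(φ(j)/j²) gcd(i,j) ∼ Δ (ln N)³`; in particular the
corresponding sum over `lcm(i,j) ≤ N`, divided by `(ln N)³`, has liminf at least `Δ`. -/
theorem sum_totient_gcd_asymptotics :
    Tendsto (fun N : ℕ =>
        (∑ p ∈ (Finset.Icc 1 N ×ˢ Finset.Icc 1 N).filter (fun p => p.1 * p.2 ≤ N),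
            (Nat.totient p.1 : ℝ) / (p.1 : ℝ) ^ 2 * ((Nat.totient p.2 : ℝ) / (p.2 : ℝ) ^ 2) *
              (Nat.gcd p.1 p.2 : ℝ)) /
          (DeltaConst * Real.log N ^ 3))
      atTop (nhds 1) ∧
    DeltaConst ≤ liminf (fun N : ℕ =>
        (1 / Real.log N ^ 3) *
          ∑ p ∈ (Finset.Icc 1 N ×ˢ Finset.Icc 1 N).filter (fun p => Nat.lcm p.1 p.2 ≤ N),
            (Nat.totient p.1 : ℝ) / (p.1 : ℝ) ^ 2 * ((Nat.totient p.2 : ℝ) / (p.2 : ℝ) ^ 2) *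
              (Nat.gcd p.1 p.2 : ℝ)) atTop := by
  have hlog : Tendsto (fun N : ℕ => Real.log N) atTop atTop :=
    Real.tendsto_log_atTop.comp tendsto_natCast_atTop_atTop
  have hlog1 : ∀ᶠ N : ℕ in atTop, 1 ≤ Real.log N := hlog.eventually_ge_atTop 1
  obtain ⟨K, hK⟩ := abs_sum_gcd_sub_le
  set S : ℕ → ℝ := fun N =>
    ∑ p ∈ (Finset.Icc 1 N ×ˢ Finset.Icc 1 N).filter (fun p => p.1 * p.2 ≤ N),
      (Nat.totient p.1 : ℝ) / (p.1 : ℝ) ^ 2 * ((Nat.totient p.2 : ℝ) / (p.2 : ℝ) ^ 2) *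
        (Nat.gcd p.1 p.2 : ℝ) with hS
  have hlim : Tendsto (fun N : ℕ => S N / Real.log N ^ 3) atTop (nhds DeltaConst) := by
    rw [tendsto_iff_norm_sub_tendsto_zero]
    have hz : Tendsto (fun N : ℕ => 4 * |K| * (Real.log N)⁻¹) atTop (nhds 0) := by
      simpa using (tendsto_inv_atTop_zero.comp hlog).const_mul (4 * |K|)
    refine squeeze_zero' (Eventually.of_forall fun _ => norm_nonneg _) ?_ hz
    filter_upwards [hlog1, eventually_ge_atTop 1] with N hL hN
    have hL0 : 0 < Real.log N := by linarith
    have h1 : S N / Real.log N ^ 3 - DeltaConst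
        = (S N - DeltaConst * Real.log N ^ 3) / Real.log N ^ 3 := by field_simp
    rw [h1, Real.norm_eq_abs, abs_div, abs_of_pos (pow_pos hL0 3), div_le_iff₀ (by positivity)]
    refine (hK N hN).trans ?_
    calc K * (1 + Real.log N) ^ 2 ≤ |K| * (2 * Real.log N) ^ 2 := by
          gcongr
          · exact le_abs_self K
          · linarith
      _ = _ := by field_simp; ring
  refine ⟨?_, ?_⟩
  · have := hlim.div_const DeltaConst
    rw [div_self DeltaConst_ne_zero] at this
    refine this.congr fun N => ?_
    rw [div_div, mul_comm]
  · rw [← hlim.liminf_eq]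
    refine liminf_le_liminf ?_ hlim.isBoundedUnder_ge ?_
    · filter_upwards [hlog1] with N hL
      rw [div_eq_inv_mul, ← one_div]
      have hL0 : 0 < Real.log N := by linarith
      refine mul_le_mul_of_nonneg_left ?_ (by positivity)
      refine Finset.sum_le_sum_of_subset_of_nonneg ?_ fun _ _ _ => by positivity
      intro p hp
      simp only [Finset.mem_filter, Finset.mem_product, Finset.mem_Icc] at hp ⊢
      exact ⟨hp.1, (Nat.le_of_dvd (Nat.mul_pos hp.1.1.1 hp.1.2.1) (Nat.lcm_dvd_mul _ _)).trans hp.2⟩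
    · refine IsBoundedUnder.isCoboundedUnder_ge ?_
      refine isBoundedUnder_of_eventually_le (a := 8) ?_
      filter_upwards [hlog1, eventually_ge_atTop 1] with N hL hN
      have hL0 : 0 < Real.log N := by linarith
      rw [one_div, inv_mul_le_iff₀ (by positivity)]
      refine (sum_lcm_le hN).trans ?_
      calc (1 + Real.log N) ^ 3 ≤ (2 * Real.log N) ^ 3 := by
            gcongr
            linarith
        _ = _ := by ring
end

section
/- For every real t > 1 and every integer s ≥ 1, Σ_{i,j≥1} (φ_s(i)/i^{s+t}) · (φ_s(j)/j^{s+t}) · gcd(i,j) = ζ(2t−1)·ζ(t)² · Π_p (1 − 2/p^{t+s} − 1/p^{2t} − 2/p^{2t+s−1} + 2/p^{2t+s} + 1/p^{2t+2s−1} + 2/p^{3t+s−1} − 1/p^{4t+2s−1}), the product over all primes p. -/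
/-- Jordan's totient function `φ_s(k) = k^s Π_{p|k} (1 − 1/p^s)`, as a real number. -/
noncomputable def jordanTotient (s k : ℕ) : ℝ :=
  (k : ℝ) ^ s * ∏ p ∈ k.primeFactors, (1 - 1 / (p : ℝ) ^ s)

theorem sum_divisorsAntidiagonal_mul_of_coprime {R : Type*} [CommSemiring R] {h : ℕ → ℕ → R}
    (hmul : ∀ a b c d : ℕ, (a * b).Coprime (c * d) → h (a * c) (b * d) = h a b * h c d)
    {m n : ℕ} (cop : m.Coprime n) :
    ∑ q ∈ (m * n).divisorsAntidiagonal, h q.1 q.2 =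
      (∑ q ∈ m.divisorsAntidiagonal, h q.1 q.2) * ∑ q ∈ n.divisorsAntidiagonal, h q.1 q.2 := by
  rw [Nat.sum_divisorsAntidiagonal, Nat.sum_divisorsAntidiagonal, Nat.sum_divisorsAntidiagonal,
    Nat.divisors_mul, Finset.mul_def, Finset.sum_image cop.mul_injOn_divisors,
    Finset.sum_product, Finset.sum_mul_sum]
  refine Finset.sum_congr rfl fun a ha => Finset.sum_congr rfl fun c hc => ?_
  have ha' := Nat.dvd_of_mem_divisors ha
  have hc' := Nat.dvd_of_mem_divisors hc
  rw [← Nat.div_mul_div_comm ha' hc', hmul]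
  rwa [Nat.mul_div_cancel' ha', Nat.mul_div_cancel' hc']

theorem sum_divisorsAntidiagonal_prime_pow {M : Type*} [AddCommMonoid M] (h : ℕ → ℕ → M)
    {p : ℕ} (hp : p.Prime) (e : ℕ) :
    ∑ q ∈ (p ^ e).divisorsAntidiagonal, h q.1 q.2 =
      ∑ q ∈ Finset.HasAntidiagonal.antidiagonal e, h (p ^ q.1) (p ^ q.2) := by
  rw [Nat.sum_divisorsAntidiagonal, Nat.sum_divisors_prime_pow hp,
    Finset.Nat.sum_antidiagonal_eq_sum_range_succ (fun a b => h (p ^ a) (p ^ b))]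
  refine Finset.sum_congr rfl fun k hk => ?_
  rw [Nat.pow_div (Nat.lt_succ_iff.mp (Finset.mem_range.mp hk)) hp.pos]

/-- The injection sending a pair of exponents `(a, b)` to `(p ^ a, p ^ b)`. -/
def primePowPair (p : Nat.Primes) (q : ℕ × ℕ) : ℕ+ × ℕ+ :=
  (⟨(p : ℕ) ^ q.1, pow_pos p.2.pos _⟩, ⟨(p : ℕ) ^ q.2, pow_pos p.2.pos _⟩)

theorem primePowPair_injective (p : Nat.Primes) : Function.Injective (primePowPair p) := by
  rintro ⟨a, b⟩ ⟨c, d⟩ h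
  have h1 : (p : ℕ) ^ a = (p : ℕ) ^ c := congrArg (fun q : ℕ+ × ℕ+ => (q.1 : ℕ)) h
  have h2 : (p : ℕ) ^ b = (p : ℕ) ^ d := congrArg (fun q : ℕ+ × ℕ+ => (q.2 : ℕ)) h
  exact Prod.ext (Nat.pow_right_injective p.2.two_le h1) (Nat.pow_right_injective p.2.two_le h2)

/-- The Euler product of a two-variable multiplicative function. -/
theorem hasProd_tsum_prime_pow_pair_s12 {h : ℕ → ℕ → ℝ} (h_one : h 1 1 = 1)
    (hmul : ∀ a b c d : ℕ, (a * b).Coprime (c * d) → h (a * c) (b * d) = h a b * h c d)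
    (hsum : Summable fun q : ℕ+ × ℕ+ => h q.1 q.2) :
    HasProd (fun p : Nat.Primes => ∑' q : ℕ × ℕ, h ((p : ℕ) ^ q.1) ((p : ℕ) ^ q.2))
      (∑' q : ℕ+ × ℕ+, h q.1 q.2) := by
  set G : ℕ → ℝ := fun n => ∑ q ∈ n.divisorsAntidiagonal, h q.1 q.2 with hG
  have hG0 : G 0 = 0 := by simp [hG]
  have hsig := sigmaAntidiagonalEquivProd.summable_iff.mpr hsum
  have hfib (n : ℕ+) : ∑' c : Nat.divisorsAntidiagonal n,
      ((fun q : ℕ+ × ℕ+ => h q.1 q.2) ∘ sigmaAntidiagonalEquivProd) ⟨n, c⟩ = G n := by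
    rw [tsum_fintype]
    exact (n : ℕ).divisorsAntidiagonal.sum_attach fun q => h q.1 q.2
  have hsupp : Function.support G ⊆ Set.range ((↑) : ℕ+ → ℕ) := by
    intro n hn
    exact ⟨⟨n, Nat.pos_of_ne_zero fun h0 => hn (h0 ▸ hG0)⟩, rfl⟩
  have hGsum : Summable G := by
    rw [← PNat.coe_injective.summable_iff fun n hn => by_contra fun h0 => hn (hsupp h0)]
    exact (summable_congr hfib).mp hsig.sigma
  have htsum : ∑' n, G n = ∑' q : ℕ+ × ℕ+, h q.1 q.2 := by
    rw [← PNat.coe_injective.tsum_eq hsupp, ← sigmaAntidiagonalEquivProd.tsum_eq]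
    exact (tsum_congr fun n => (hfib n).symm).trans hsig.tsum_sigma.symm
  have key := EulerProduct.eulerProduct_hasProd (f := G) (by simp [hG, h_one])
    (fun cop => sum_divisorsAntidiagonal_mul_of_coprime hmul cop) hGsum.norm hG0
  rw [htsum] at key
  convert! key using 2 with p
  have hps : Summable fun q : ℕ × ℕ => h ((p : ℕ) ^ q.1) ((p : ℕ) ^ q.2) :=
    hsum.comp_injective (primePowPair_injective p)
  rw [← Finset.HasAntidiagonal.sigmaAntidiagonalEquivProd.tsum_eq]
  refine ((Finset.HasAntidiagonal.sigmaAntidiagonalEquivProd (A := ℕ)).summable_iff.mpr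
    hps).tsum_sigma.trans ?_
  refine tsum_congr fun e => ?_
  rw [tsum_fintype, hG]
  simp only
  rw [sum_divisorsAntidiagonal_prime_pow h p.2]
  exact (Finset.HasAntidiagonal.antidiagonal e).sum_attach fun q => h ((p : ℕ) ^ q.1) ((p : ℕ) ^ q.2)

theorem jordanTotient_one (s : ℕ) : jordanTotient s 1 = 1 := by
  simp [jordanTotient]

theorem jordanTotient_mul (s : ℕ) {m n : ℕ} (cop : m.Coprime n) :
    jordanTotient s (m * n) = jordanTotient s m * jordanTotient s n := by
  rw [jordanTotient, jordanTotient, jordanTotient, cop.primeFactors_mul,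
    Finset.prod_union cop.disjoint_primeFactors]
  push_cast
  ring

theorem jordanTotient_prime_pow_succ (s : ℕ) {p : ℕ} (hp : p.Prime) (a : ℕ) :
    jordanTotient s (p ^ (a + 1)) = ((p : ℝ) ^ (a + 1)) ^ s * (1 - 1 / (p : ℝ) ^ s) := by
  rw [jordanTotient, Nat.primeFactors_prime_pow a.succ_ne_zero hp, Finset.prod_singleton]
  push_cast
  rfl

theorem one_sub_one_div_pow_mem_Icc (s p : ℕ) :
    1 - 1 / (p : ℝ) ^ s ∈ Set.Icc (0 : ℝ) 1 := by
  refine ⟨?_, sub_le_self _ (by positivity)⟩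
  rw [sub_nonneg, one_div, ← inv_pow]
  exact pow_le_one₀ (by positivity) (Nat.cast_inv_le_one p)

theorem jordanTotient_nonneg (s n : ℕ) : 0 ≤ jordanTotient s n :=
  mul_nonneg (by positivity)
    (Finset.prod_nonneg fun p _ => (one_sub_one_div_pow_mem_Icc s p).1)

theorem jordanTotient_le_pow (s n : ℕ) : jordanTotient s n ≤ (n : ℝ) ^ s :=
  mul_le_of_le_one_right (by positivity)
    (Finset.prod_le_one (fun p _ => (one_sub_one_div_pow_mem_Icc s p).1)
      fun p _ => (one_sub_one_div_pow_mem_Icc s p).2)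

theorem jordanTotient_div_rpow_le (s : ℕ) (t : ℝ) (n : ℕ+) :
    jordanTotient s n / (n : ℝ) ^ ((s : ℝ) + t) ≤ 1 / (n : ℝ) ^ t := by
  have hn : (0 : ℝ) < n := by exact_mod_cast n.pos
  rw [Real.rpow_add hn, Real.rpow_natCast, div_le_div_iff₀ (by positivity) (by positivity), one_mul]
  gcongr
  exact jordanTotient_le_pow s n

theorem summable_one_div_pnat_rpow {t : ℝ} (ht : 1 < t) :
    Summable fun n : ℕ+ => 1 / (n : ℝ) ^ t :=
  (Real.summable_one_div_nat_rpow.mpr ht).comp_injective PNat.coe_injective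

theorem zetaReal_pos_s12 {t : ℝ} (ht : 1 < t) : 0 < zetaReal t :=
  (summable_one_div_pnat_rpow ht).tsum_pos (fun n => by positivity) 1 (by simp)

theorem summable_one_div_rpow_mul_gcd {t : ℝ} (ht : 1 < t) :
    Summable fun q : ℕ+ × ℕ+ =>
      1 / (q.1 : ℝ) ^ t * (1 / (q.2 : ℝ) ^ t) * (Nat.gcd q.1 q.2 : ℝ) := by
  have hs := summable_one_div_pnat_rpow ht
  have hs' := summable_one_div_pnat_rpow (t := 2 * t - 1) (by linarith)
  have h3 := hs'.mul_of_nonneg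
    (hs.mul_of_nonneg hs (fun n => by positivity) (fun n => by positivity))
    (fun n => by positivity) (fun n => by positivity)
  set φ : ℕ+ × ℕ+ → ℕ+ × ℕ+ × ℕ+ := fun q =>
    (⟨Nat.gcd q.1 q.2, Nat.gcd_pos_of_pos_left _ q.1.pos⟩,
      ⟨q.1 / Nat.gcd q.1 q.2, Nat.div_gcd_pos_of_pos_left _ q.1.pos⟩,
      ⟨q.2 / Nat.gcd q.1 q.2, Nat.div_gcd_pos_of_pos_right _ q.2.pos⟩) with hφ
  have e1 (q : ℕ+ × ℕ+) : (q.1 : ℕ) = (φ q).1 * (φ q).2.1 :=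
    (Nat.mul_div_cancel' (Nat.gcd_dvd_left _ _)).symm
  have e2 (q : ℕ+ × ℕ+) : (q.2 : ℕ) = (φ q).1 * (φ q).2.2 :=
    (Nat.mul_div_cancel' (Nat.gcd_dvd_right _ _)).symm
  have hinj : Function.Injective φ := fun q r hqr =>
    Prod.ext (PNat.coe_injective (by rw [e1 q, e1 r, hqr]))
      (PNat.coe_injective (by rw [e2 q, e2 r, hqr]))
  refine (h3.comp_injective hinj).congr fun q => ?_
  have h1 : (q.1 : ℝ) = ((φ q).1 : ℝ) * ((φ q).2.1 : ℝ) := by exact_mod_cast e1 q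
  have h2 : (q.2 : ℝ) = ((φ q).1 : ℝ) * ((φ q).2.2 : ℝ) := by exact_mod_cast e2 q
  have hg : (Nat.gcd q.1 q.2 : ℝ) = ((φ q).1 : ℝ) := rfl
  have hd : (0 : ℝ) < (φ q).1 := by exact_mod_cast (φ q).1.pos
  rw [h1, h2, hg, Real.mul_rpow (by positivity) (by positivity),
    Real.mul_rpow (by positivity) (by positivity), Function.comp_apply,
    Real.rpow_sub_one hd.ne', two_mul, Real.rpow_add hd]
  field_simp

theorem hasProd_one_sub_one_div_rpow {t : ℝ} (ht : 1 < t) :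
    HasProd (fun p : Nat.Primes => 1 - 1 / ((p : ℕ) : ℝ) ^ t) (zetaReal t)⁻¹ := by
  have ht0 : t ≠ 0 := by linarith
  let f : ℕ →*₀ ℝ :=
    { toFun := fun n => 1 / (n : ℝ) ^ t
      map_zero' := by simp [Real.zero_rpow ht0]
      map_one' := by simp
      map_mul' := fun m n => by
        rw [Nat.cast_mul, Real.mul_rpow (by positivity) (by positivity), one_div_mul_one_div] }
  have hf : Summable (fun n => f n) := Real.summable_one_div_nat_rpow.mpr ht
  have key := EulerProduct.eulerProduct_completely_multiplicative_hasProd hf.norm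
  have hz : ∑' n, f n = zetaReal t := by
    refine (PNat.coe_injective.tsum_eq fun n hn => ?_).symm
    exact ⟨⟨n, Nat.pos_of_ne_zero fun h0 => hn (h0 ▸ f.map_zero)⟩, rfl⟩
  rw [hz] at key
  simpa only [inv_inv] using! key.inv₀ (zetaReal_pos_s12 ht).ne'

theorem tsum_prod_eq_add_tsum_succ {h : ℕ × ℕ → ℝ} (hh : Summable h) :
    ∑' q, h q = ∑' b, h (0, b) + ∑' a, h (a + 1, 0) + ∑' q : ℕ × ℕ, h (q.1 + 1, q.2 + 1) := by
  have hinj : Function.Injective fun q : ℕ × ℕ => (q.1 + 1, q.2 + 1) := fun q r h => by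
    simpa [Prod.ext_iff] using h
  have h1 : Summable fun a => ∑' b, h (a + 1, b) := (summable_nat_add_iff 1).mpr hh.prod
  have h2 (a : ℕ) : ∑' b, h (a, b) = h (a, 0) + ∑' b, h (a, b + 1) :=
    (hh.prod_factor a).tsum_eq_zero_add
  have h3 := hh.comp_injective hinj
  have h4 : Summable fun a => h (a + 1, 0) :=
    hh.comp_injective (i := fun a : ℕ => (a + 1, 0)) fun a b hab => by simpa using hab
  rw [hh.tsum_prod, hh.prod.tsum_eq_zero_add, tsum_congr fun a => h2 (a + 1),
    h4.tsum_add (g := fun a => ∑' b, h (a + 1, b + 1)) h3.prod, add_assoc]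
  exact congrArg _ (congrArg _ h3.tsum_prod.symm)

theorem tsum_pow_mul_pow_min {x P : ℝ} (hx : |x| < 1) (hP : P * x ^ 2 ≠ 1)
    (hsum : Summable fun q : ℕ × ℕ => x ^ q.1 * x ^ q.2 * P ^ min q.1 q.2) :
    ∑' q : ℕ × ℕ, x ^ q.1 * x ^ q.2 * P ^ min q.1 q.2 =
      (1 + x) / ((1 - x) * (1 - P * x ^ 2)) := by
  have hx1 : 1 - x ≠ 0 := by linarith [(abs_lt.mp hx).2]
  have hP1 : 1 - P * x ^ 2 ≠ 0 := sub_ne_zero.mpr hP.symm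
  have key := tsum_prod_eq_add_tsum_succ hsum
  have hrec (q : ℕ × ℕ) : x ^ (q.1 + 1) * x ^ (q.2 + 1) * P ^ min (q.1 + 1) (q.2 + 1) =
      P * x ^ 2 * (x ^ q.1 * x ^ q.2 * P ^ min q.1 q.2) := by
    rw [Nat.add_min_add_right]; ring
  have hsucc : ∑' a : ℕ, x ^ (a + 1) = x * (1 - x)⁻¹ := by
    simp only [pow_succ', tsum_mul_left, tsum_geometric_of_abs_lt_one hx]
  simp only [hrec, tsum_mul_left, pow_zero, one_mul, mul_one, Nat.zero_min, Nat.min_zero,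
    hsucc, tsum_geometric_of_abs_lt_one hx] at key
  set T := ∑' q : ℕ × ℕ, x ^ q.1 * x ^ q.2 * P ^ min q.1 q.2
  have : T * (1 - P * x ^ 2) * (1 - x) = 1 + x := by
    linear_combination (1 - x) * key + (1 + x) * inv_mul_cancel₀ hx1
  rw [eq_div_iff (mul_ne_zero hx1 hP1)]
  linear_combination this

theorem tsum_mul_pow_min {x P c : ℝ} {u : ℕ → ℝ} (hx : |x| < 1) (hP : P * x ^ 2 ≠ 1)
    (hu0 : u 0 = 1) (hu : ∀ a, u (a + 1) = c * x ^ (a + 1))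
    (hsum : Summable fun q : ℕ × ℕ => x ^ q.1 * x ^ q.2 * P ^ min q.1 q.2)
    (hsum' : Summable fun q : ℕ × ℕ => u q.1 * u q.2 * P ^ min q.1 q.2) :
    ∑' q : ℕ × ℕ, u q.1 * u q.2 * P ^ min q.1 q.2 =
      1 + 2 * c * x / (1 - x) +
        c ^ 2 * (P * x ^ 2) * ((1 + x) / ((1 - x) * (1 - P * x ^ 2))) := by
  have hsucc : ∑' a : ℕ, u (a + 1) = c * x * (1 - x)⁻¹ := by
    simp only [hu, pow_succ', tsum_mul_left, tsum_geometric_of_abs_lt_one hx, mul_assoc]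
  have husum : Summable u := by
    refine (summable_nat_add_iff 1).mp ?_
    simp only [hu]
    exact ((summable_nat_add_iff 1).mpr (summable_geometric_of_abs_lt_one hx)).mul_left c
  have key := tsum_prod_eq_add_tsum_succ hsum'
  have hrec (q : ℕ × ℕ) : u (q.1 + 1) * u (q.2 + 1) * P ^ min (q.1 + 1) (q.2 + 1) =
      c ^ 2 * (P * x ^ 2) * (x ^ q.1 * x ^ q.2 * P ^ min q.1 q.2) := by
    rw [Nat.add_min_add_right, hu, hu]; ring
  simp only [hrec, tsum_mul_left, pow_zero, one_mul, mul_one, Nat.zero_min, Nat.min_zero,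
    hu0, hsucc, husum.tsum_eq_zero_add, tsum_pow_mul_pow_min hx hP hsum] at key
  rw [key]
  ring

theorem jordanTotient_div_rpow_prime_pow_succ (s : ℕ) (t : ℝ) {p : ℕ} (hp : p.Prime) (a : ℕ) :
    jordanTotient s (p ^ (a + 1)) / ((p ^ (a + 1) : ℕ) : ℝ) ^ ((s : ℝ) + t) =
      (1 - 1 / (p : ℝ) ^ s) * (1 / (p : ℝ) ^ t) ^ (a + 1) := by
  have hp0 : (0 : ℝ) < p := by exact_mod_cast hp.pos
  rw [jordanTotient_prime_pow_succ s hp, Nat.cast_pow, Real.rpow_add (by positivity),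
    Real.rpow_natCast, ← Real.rpow_natCast_mul hp0.le, mul_comm ((a + 1 : ℕ) : ℝ) t,
    Real.rpow_mul_natCast hp0.le, one_div_pow]
  field_simp

theorem gcd_pow_pow_eq_pow_min {p : ℕ} (a b : ℕ) : Nat.gcd (p ^ a) (p ^ b) = p ^ min a b := by
  rcases le_total a b with h | h
  · rw [Nat.gcd_eq_left (pow_dvd_pow p h), min_eq_left h]
  · rw [Nat.gcd_eq_right (pow_dvd_pow p h), min_eq_right h]

theorem gcd_mul_mul_of_coprime {a b c d : ℕ} (cop : (a * b).Coprime (c * d)) :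
    Nat.gcd (a * c) (b * d) = Nat.gcd a b * Nat.gcd c d := by
  have hbd : b.Coprime d := cop.coprime_mul_left.coprime_mul_left_right
  have had : a.Coprime d := cop.coprime_mul_right.coprime_mul_left_right
  have hbc : b.Coprime c := cop.coprime_mul_left.coprime_mul_right_right
  rw [hbd.gcd_mul, hbc.symm.gcd_mul_right_cancel, had.gcd_mul_left_cancel]

theorem tsum_jordanTotient_prime_pow_mul_gcd {t : ℝ} (ht : 1 < t) (s : ℕ) (p : Nat.Primes)
    (hsum : Summable fun q : ℕ+ × ℕ+ =>
      jordanTotient s q.1 / (q.1 : ℝ) ^ ((s : ℝ) + t) *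
        (jordanTotient s q.2 / (q.2 : ℝ) ^ ((s : ℝ) + t)) * (Nat.gcd q.1 q.2 : ℝ)) :
    (∑' q : ℕ × ℕ,
        jordanTotient s ((p : ℕ) ^ q.1) / (((p : ℕ) ^ q.1 : ℕ) : ℝ) ^ ((s : ℝ) + t) *
          (jordanTotient s ((p : ℕ) ^ q.2) / (((p : ℕ) ^ q.2 : ℕ) : ℝ) ^ ((s : ℝ) + t)) *
          (Nat.gcd ((p : ℕ) ^ q.1) ((p : ℕ) ^ q.2) : ℝ)) *
        (1 - 1 / ((p : ℕ) : ℝ) ^ (2 * t - 1)) *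
        ((1 - 1 / ((p : ℕ) : ℝ) ^ t) * (1 - 1 / ((p : ℕ) : ℝ) ^ t)) =
      1 - 2 / ((p : ℕ) : ℝ) ^ (t + s) - 1 / ((p : ℕ) : ℝ) ^ (2 * t)
        - 2 / ((p : ℕ) : ℝ) ^ (2 * t + s - 1) + 2 / ((p : ℕ) : ℝ) ^ (2 * t + s)
        + 1 / ((p : ℕ) : ℝ) ^ (2 * t + 2 * s - 1) + 2 / ((p : ℕ) : ℝ) ^ (3 * t + s - 1)
        - 1 / ((p : ℕ) : ℝ) ^ (4 * t + 2 * s - 1) := by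
  obtain ⟨p, hp⟩ := p
  have hp0 : (0 : ℝ) < p := by exact_mod_cast hp.pos
  have hp1 : (1 : ℝ) < p := by exact_mod_cast hp.one_lt
  have hpair := primePowPair_injective ⟨p, hp⟩
  have hX1 : 1 < (p : ℝ) ^ t := Real.one_lt_rpow hp1 (by linarith)
  have hPX : (p : ℝ) < ((p : ℝ) ^ t) ^ 2 := by
    rw [← Real.rpow_mul_natCast hp0.le]
    exact Real.self_lt_rpow_of_one_lt hp1 (by push_cast; linarith)
  have hx : |1 / (p : ℝ) ^ t| < 1 := by
    rw [abs_of_pos (by positivity), div_lt_one (by positivity)]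
    exact hX1
  have hP : (p : ℝ) * (1 / (p : ℝ) ^ t) ^ 2 ≠ 1 := by
    rw [div_pow, one_pow, mul_one_div, ne_eq, div_eq_one_iff_eq (by positivity)]
    exact hPX.ne
  have hsum1 : Summable fun q : ℕ × ℕ =>
      (1 / (p : ℝ) ^ t) ^ q.1 * (1 / (p : ℝ) ^ t) ^ q.2 * (p : ℝ) ^ min q.1 q.2 := by
    refine ((summable_one_div_rpow_mul_gcd ht).comp_injective hpair).congr fun q => ?_
    simp only [Function.comp_apply, primePowPair, PNat.mk_coe, gcd_pow_pow_eq_pow_min, Nat.cast_pow,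
      ← Real.rpow_natCast_mul hp0.le, one_div, inv_pow, ← Real.rpow_mul_natCast hp0.le, mul_comm t]
  have hsum2 := hsum.comp_injective hpair
  have key := tsum_mul_pow_min (c := 1 - 1 / (p : ℝ) ^ s)
    (u := fun a => jordanTotient s (p ^ a) / ((p ^ a : ℕ) : ℝ) ^ ((s : ℝ) + t)) hx hP
    (by simp [jordanTotient_one]) (jordanTotient_div_rpow_prime_pow_succ s t hp) hsum1
    (hsum2.congr fun q => by
      simp only [Function.comp_apply, primePowPair, PNat.mk_coe, gcd_pow_pow_eq_pow_min, Nat.cast_pow])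
  simp only [gcd_pow_pow_eq_pow_min, Nat.cast_pow] at key ⊢
  rw [key]
  have e1 : (p : ℝ) ^ (2 * t) = ((p : ℝ) ^ t) ^ 2 := by
    rw [← Real.rpow_mul_natCast hp0.le, mul_comm]; norm_num
  have e3 : (p : ℝ) ^ (3 * t) = ((p : ℝ) ^ t) ^ 3 := by
    rw [← Real.rpow_mul_natCast hp0.le, mul_comm]; norm_num
  have e4 : (p : ℝ) ^ (4 * t) = ((p : ℝ) ^ t) ^ 4 := by
    rw [← Real.rpow_mul_natCast hp0.le, mul_comm]; norm_num
  have e2 : (p : ℝ) ^ (2 * (s : ℝ)) = ((p : ℝ) ^ s) ^ 2 := by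
    rw [← Real.rpow_natCast p s, ← Real.rpow_mul_natCast hp0.le, mul_comm]; norm_num
  simp only [Real.rpow_sub_one hp0.ne', Real.rpow_add hp0, e1, e2, e3, e4, Real.rpow_natCast]
  set X := (p : ℝ) ^ t
  have hY : (p : ℝ) ^ s ≠ 0 := by positivity
  set Y := (p : ℝ) ^ s
  have h1 : X - 1 ≠ 0 := by linarith
  have h2 : X ^ 2 - p ≠ 0 := by linarith
  have hX0 : X ≠ 0 := by linarith
  have h3 : 1 - 1 / X = (X - 1) / X := by field_simp
  have h4 : 1 - (p : ℝ) * (1 / X) ^ 2 = (X ^ 2 - p) / X ^ 2 := by field_simp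
  rw [h3, h4]
  field_simp
  ring

/-- For every real `t > 1` and integer `s ≥ 1`,
`Σ_{i,j≥1} (φ_s(i)/i^{s+t})(φ_s(j)/j^{s+t}) gcd(i,j)` equals
`ζ(2t−1) ζ(t)² Π_p (1 − 2/p^{t+s} − 1/p^{2t} − 2/p^{2t+s−1} + 2/p^{2t+s} + 1/p^{2t+2s−1}
 + 2/p^{3t+s−1} − 1/p^{4t+2s−1})`. -/
theorem double_sum_jordanTotient_gcd (t : ℝ) (ht : 1 < t) (s : ℕ) (hs : 1 ≤ s) :
    (∑' p : ℕ+ × ℕ+,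
        jordanTotient s p.1 / (p.1 : ℝ) ^ ((s : ℝ) + t) *
          (jordanTotient s p.2 / (p.2 : ℝ) ^ ((s : ℝ) + t)) * (Nat.gcd p.1 p.2 : ℝ)) =
      zetaReal (2 * t - 1) * zetaReal t ^ 2 *
        ∏' p : Nat.Primes,
          (1 - 2 / ((p : ℕ) : ℝ) ^ (t + s) - 1 / ((p : ℕ) : ℝ) ^ (2 * t)
            - 2 / ((p : ℕ) : ℝ) ^ (2 * t + s - 1) + 2 / ((p : ℕ) : ℝ) ^ (2 * t + s)
            + 1 / ((p : ℕ) : ℝ) ^ (2 * t + 2 * s - 1) + 2 / ((p : ℕ) : ℝ) ^ (3 * t + s - 1)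
            - 1 / ((p : ℕ) : ℝ) ^ (4 * t + 2 * s - 1)) := by
  set f : ℕ → ℝ := fun n => jordanTotient s n / (n : ℝ) ^ ((s : ℝ) + t) with hf
  have hf1 : f 1 = 1 := by simp [hf, jordanTotient_one]
  have hfmul {m n : ℕ} (cop : m.Coprime n) : f (m * n) = f m * f n := by
    simp only [hf]
    rw [jordanTotient_mul s cop, Nat.cast_mul, Real.mul_rpow (by positivity) (by positivity),
      mul_div_mul_comm]
  have hf0 (n : ℕ) : 0 ≤ f n := div_nonneg (jordanTotient_nonneg s n) (by positivity)
  have hgcd := summable_one_div_rpow_mul_gcd ht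
  have hsum : Summable fun q : ℕ+ × ℕ+ => f q.1 * f q.2 * (Nat.gcd q.1 q.2 : ℝ) := by
    refine hgcd.of_nonneg_of_le
      (fun q => mul_nonneg (mul_nonneg (hf0 _) (hf0 _)) (by positivity)) fun q => ?_
    gcongr
    · exact hf0 _
    · exact jordanTotient_div_rpow_le s t q.1
    · exact jordanTotient_div_rpow_le s t q.2
  have hA := hasProd_tsum_prime_pow_pair_s12 (h := fun a b => f a * f b * (Nat.gcd a b : ℝ))
    (by simp [hf1])
    (fun a b c d cop => by
      rw [gcd_mul_mul_of_coprime cop, hfmul cop.coprime_mul_right.coprime_mul_right_right,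
        hfmul cop.coprime_mul_left.coprime_mul_left_right]
      push_cast
      ring) hsum
  have hB := hasProd_one_sub_one_div_rpow (t := 2 * t - 1) (by linarith)
  have hC := hasProd_one_sub_one_div_rpow ht
  have hz1 := (zetaReal_pos_s12 (t := 2 * t - 1) (by linarith)).ne'
  have hz2 := (zetaReal_pos_s12 ht).ne'
  have key := (hA.mul hB).mul (hC.mul hC)
  rw [← tprod_congr fun p => tsum_jordanTotient_prime_pow_mul_gcd ht s p hsum, key.tprod_eq]
  change ∑' q : ℕ+ × ℕ+, f q.1 * f q.2 * (Nat.gcd q.1 q.2 : ℝ) = _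
  generalize zetaReal (2 * t - 1) = z at hz1 ⊢
  field_simp
end

section
/- For each integer s ≥ 1, let Δ_s = (1/12)·Π_p (1 − 4/p^{s+1} − 1/p² + 4/p^{s+2} + 1/p^{2s+1} − 1/p^{2s+3}), the product over all primes p. Then liminf_{N→∞} (ln N)^{-3} · Σ_{lcm(i,j) ≤ N} (φ_s(i)/i^{s+1})·(φ_s(j)/j^{s+1})·gcd(i,j) ≥ Δ_s. -/
open Filter

/-- The constant `Δ_s = (1/12) Π_p (1 − 4/p^{s+1} − 1/p² + 4/p^{s+2} + 1/p^{2s+1} − 1/p^{2s+3})`. -/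
noncomputable def DeltaS (s : ℕ) : ℝ :=
  (1 / 12) * ∏' p : Nat.Primes,
    (1 - 4 / ((p : ℕ) : ℝ) ^ (s + 1) - 1 / ((p : ℕ) : ℝ) ^ 2 + 4 / ((p : ℕ) : ℝ) ^ (s + 2)
      + 1 / ((p : ℕ) : ℝ) ^ (2 * s + 1) - 1 / ((p : ℕ) : ℝ) ^ (2 * s + 3))

section Helpers

open Finset ArithmeticFunction Topology
open scoped ArithmeticFunction.zeta ArithmeticFunction.Moebius

namespace ArithmeticFunction

/-- The arithmetic function `n ↦ f n / n`. -/
noncomputable def divSelf (f : ArithmeticFunction ℝ) : ArithmeticFunction ℝ :=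
  f.pdiv ((ArithmeticFunction.id : ArithmeticFunction ℕ) : ArithmeticFunction ℝ)

lemma divSelf_apply (f : ArithmeticFunction ℝ) (n : ℕ) : f.divSelf n = f n / n := by
  simp [divSelf]

lemma divSelf_mul (f g : ArithmeticFunction ℝ) : (f * g).divSelf = f.divSelf * g.divSelf := by
  ext n
  simp only [divSelf_apply, mul_apply, sum_div]
  refine sum_congr rfl fun x hx => ?_
  rw [← (Nat.mem_divisorsAntidiagonal.1 hx).1]
  push_cast
  rw [mul_div_mul_comm]

lemma IsMultiplicative.divSelf {f : ArithmeticFunction ℝ} (hf : f.IsMultiplicative) :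
    f.divSelf.IsMultiplicative :=
  hf.pdiv isMultiplicative_id.natCast

lemma IsMultiplicative.summable_norm_of_tsum_prime_pow_le {f : ArithmeticFunction ℝ}
    (hf : f.IsMultiplicative) {g : ℕ → ℝ} (hg : Summable g) (hg₀ : ∀ n, 0 ≤ g n)
    (hsum : ∀ {p : ℕ}, p.Prime → Summable fun k : ℕ => ‖f (p ^ k)‖)
    (hle : ∀ p : ℕ, p.Prime → ∑' k : ℕ, ‖f (p ^ k)‖ ≤ 1 + g p) :
    Summable fun n => ‖f n‖ := by
  refine summable_of_sum_range_le (c := Real.exp (∑' n, g n)) (fun _ => norm_nonneg _) fun N => ?_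
  have key := EulerProduct.summable_and_hasSum_smoothNumbers_prod_primesBelow_tsum
    (f := fun n => ‖f n‖) (by simp [hf.map_one])
    (fun {m n} h => by simp [hf.map_mul_of_coprime h]) (fun hp => by simpa using hsum hp) N
  have h₁ : ∑ n ∈ range N, ‖f n‖ ≤ ∑' m : N.smoothNumbers, ‖f m‖ := by
    rw [tsum_subtype N.smoothNumbers (fun m => ‖f m‖)]
    have hs : Summable (N.smoothNumbers.indicator fun m => ‖f m‖) :=
      summable_subtype_iff_indicator.1 key.2.summable
    refine le_trans (sum_le_sum fun n hn => ?_) (hs.sum_le_tsum (range N) fun n _ => ?_)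
    · rcases Nat.eq_zero_or_pos n with rfl | h
      · simp only [map_zero, norm_zero]
        exact Set.indicator_nonneg (fun _ _ => norm_nonneg _) _
      · rw [Set.indicator_of_mem (Nat.mem_smoothNumbers_of_lt h (mem_range.1 hn))]
    · exact Set.indicator_nonneg (fun _ _ => norm_nonneg _) _
  refine h₁.trans ?_
  rw [key.2.tsum_eq]
  calc ∏ p ∈ N.primesBelow, ∑' k : ℕ, ‖f (p ^ k)‖
      ≤ ∏ p ∈ N.primesBelow, Real.exp (g p) := by
        refine prod_le_prod (fun p _ => tsum_nonneg fun _ => norm_nonneg _) fun p hp => ?_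
        refine (hle p (Nat.prime_of_mem_primesBelow hp)).trans ?_
        linarith [Real.add_one_le_exp (g p)]
    _ = Real.exp (∑ p ∈ N.primesBelow, g p) := (Real.exp_sum _ _).symm
    _ ≤ _ := Real.exp_le_exp.2 (hg.sum_le_tsum _ fun n _ => hg₀ n)

lemma sum_Ioc_zero_eq_sum_range (f : ℕ → ℝ) (N : ℕ) :
    ∑ n ∈ Ioc 0 N, f n = ∑ n ∈ range N, f (n + 1) := by
  induction N with
  | zero => simp
  | succ N ih => rw [sum_Ioc_succ_top (Nat.zero_le N), sum_range_succ, ih]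

lemma sum_divSelf_zeta_pow_succ (k N : ℕ) :
    ∑ n ∈ Ioc 0 N, ((ζ : ArithmeticFunction ℝ) ^ (k + 1)).divSelf n =
      ∑ n ∈ Ioc 0 N, 1 / (n : ℝ) *
        ∑ m ∈ Ioc 0 (N / n), ((ζ : ArithmeticFunction ℝ) ^ k).divSelf m := by
  rw [pow_succ', divSelf_mul, sum_Ioc_mul_eq_sum_sum]
  refine sum_congr rfl fun n hn => ?_
  have : n ≠ 0 := (mem_Ioc.1 hn).1.ne'
  simp [divSelf_apply, natCoe_apply, zeta_apply, this]

lemma log_succ_sub_log_le {n : ℕ} (hn : 0 < n) :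
    Real.log (n + 1 : ℕ) - Real.log n ≤ 1 / n := by
  have hn' : (0 : ℝ) < n := by exact_mod_cast hn
  rw [← Real.log_div (by positivity) (by positivity)]
  refine (Real.log_le_sub_one_of_pos (by positivity)).trans_eq ?_
  push_cast
  field_simp
  ring

lemma one_div_le_log_sub_log {n : ℕ} (hn : 0 < n) :
    1 / ((n + 1 : ℕ) : ℝ) ≤ Real.log (n + 1 : ℕ) - Real.log n := by
  have hn' : (0 : ℝ) < n := by exact_mod_cast hn
  rw [← Real.log_div (by positivity) (by positivity)]
  refine le_trans (le_of_eq ?_) (Real.one_sub_inv_le_log_of_pos (by positivity))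
  push_cast
  field_simp
  ring

lemma pow_succ_sub_le {u v : ℝ} (hv : 0 ≤ v) (h : v ≤ u) (k : ℕ) :
    u ^ (k + 1) - v ^ (k + 1) ≤ (k + 1) * u ^ k * (u - v) := by
  have hu := hv.trans h
  rw [← Commute.mul_geom_sum₂ (Commute.all u v), mul_comm]
  refine mul_le_mul_of_nonneg_right ?_ (sub_nonneg.2 h)
  refine (sum_le_card_nsmul _ _ (u ^ k) fun i hi => ?_).trans_eq (by simp)
  have hi' : i + (k - i) = k := by have := mem_range.1 hi; omega
  calc u ^ i * v ^ (k + 1 - 1 - i) ≤ u ^ i * u ^ (k - i) := by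
        simp only [Nat.add_sub_cancel]; gcongr
    _ = u ^ k := by rw [← pow_add, hi']

lemma le_pow_succ_sub {u v : ℝ} (hv : 0 ≤ v) (h : v ≤ u) (k : ℕ) :
    (k + 1) * v ^ k * (u - v) ≤ u ^ (k + 1) - v ^ (k + 1) := by
  have hu := hv.trans h
  rw [← Commute.mul_geom_sum₂ (Commute.all u v), mul_comm (u - v)]
  refine mul_le_mul_of_nonneg_right ?_ (sub_nonneg.2 h)
  refine le_trans (by simp) (card_nsmul_le_sum (range (k + 1)) _ (v ^ k) fun i hi => ?_)
  have hi' : i + (k - i) = k := by have := mem_range.1 hi; omega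
  calc v ^ k = v ^ i * v ^ (k - i) := by rw [← pow_add, hi']
    _ ≤ u ^ i * v ^ (k + 1 - 1 - i) := by
        simp only [Nat.add_sub_cancel]; gcongr

lemma log_pow_le_sum_divSelf_zeta_pow (k N : ℕ) (hN : 0 < N) :
    Real.log (N + 1 : ℕ) ^ k / k.factorial ≤
      ∑ n ∈ Ioc 0 N, ((ζ : ArithmeticFunction ℝ) ^ k).divSelf n := by
  induction k generalizing N with
  | zero =>
    rw [sum_eq_single_of_mem 1 (by simp; omega)]
    · simp [divSelf_apply]
    · intro n _ hn; simp [divSelf_apply, one_apply_ne hn]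
  | succ k ih =>
    rw [sum_divSelf_zeta_pow_succ]
    set u : ℕ → ℝ := fun n => Real.log (N + 1 : ℕ) - Real.log (n + 1 : ℕ) with hu
    have htel : ∑ n ∈ range N, (u n ^ (k + 1) - u (n + 1) ^ (k + 1)) =
        Real.log (N + 1 : ℕ) ^ (k + 1) := by
      rw [sum_range_sub']; simp [hu]
    rw [← htel, Nat.factorial_succ, sum_div, sum_Ioc_zero_eq_sum_range]
    refine sum_le_sum fun n hn => ?_
    have hn : n < N := mem_range.1 hn
    have hu₁ : 0 ≤ u (n + 1) := sub_nonneg.2 (Real.log_le_log (by positivity) (by gcongr; omega))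
    have hu₂ : u (n + 1) ≤ u n :=
      sub_le_sub_left (Real.log_le_log (by positivity) (by gcongr; omega)) _
    have hdiff : u n - u (n + 1) ≤ 1 / (n + 1 : ℕ) := by
      have := log_succ_sub_log_le (Nat.succ_pos n)
      simp only [hu, Nat.succ_eq_add_one] at this ⊢
      linarith
    have hlog : u n ≤ Real.log (N / (n + 1) + 1 : ℕ) := by
      simp only [hu]
      rw [← Real.log_div (by positivity) (by positivity)]
      refine Real.log_le_log (by positivity) ?_
      rw [div_le_iff₀ (by positivity)]
      have := Nat.lt_mul_div_succ N (Nat.succ_pos n)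
      rw [mul_comm] at this
      exact_mod_cast this
    calc (u n ^ (k + 1) - u (n + 1) ^ (k + 1)) / ((k + 1) * k.factorial : ℕ)
        ≤ ((k + 1) * u n ^ k * (1 / (n + 1 : ℕ))) / ((k + 1) * k.factorial : ℕ) := by
          gcongr
          refine (pow_succ_sub_le hu₁ hu₂ k).trans ?_
          have := hu₁.trans hu₂
          gcongr
      _ = 1 / (n + 1 : ℕ) * (u n ^ k / k.factorial) := by push_cast; field_simp
      _ ≤ 1 / (n + 1 : ℕ) * (Real.log (N / (n + 1) + 1 : ℕ) ^ k / k.factorial) := by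
          have := hu₁.trans hu₂
          gcongr
      _ ≤ _ := by
          gcongr
          exact ih _ (Nat.div_pos hn (by omega))

lemma sum_divSelf_zeta_pow_le (k N : ℕ) (hN : 0 < N) :
    ∑ n ∈ Ioc 0 N, ((ζ : ArithmeticFunction ℝ) ^ k).divSelf n ≤
      (Real.log N + k) ^ k / k.factorial := by
  induction k generalizing N with
  | zero =>
    rw [sum_eq_single_of_mem 1 (by simp; omega)]
    · simp [divSelf_apply]
    · intro n _ hn; simp [divSelf_apply, one_apply_ne hn]
  | succ k ih =>
    rw [sum_divSelf_zeta_pow_succ]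
    set w : ℕ → ℝ := fun n =>
      if n = 0 then Real.log N + (k + 1 : ℕ) else Real.log N - Real.log n + k with hw
    have hw_nonneg : ∀ n, n ≤ N → 0 ≤ w n := by
      intro n hn
      simp only [hw]
      split_ifs with h
      · have := Real.log_natCast_nonneg N; positivity
      · have : Real.log n ≤ Real.log N :=
          Real.log_le_log (by exact_mod_cast Nat.pos_of_ne_zero h) (by exact_mod_cast hn)
        have : (0 : ℝ) ≤ k := k.cast_nonneg
        linarith
    have hdiff : ∀ n : ℕ, 1 / ((n + 1 : ℕ) : ℝ) ≤ w n - w (n + 1) := by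
      intro n
      rcases Nat.eq_zero_or_pos n with rfl | h
      · simp [hw]
      · have := one_div_le_log_sub_log h
        simp only [hw, h.ne', if_false, Nat.succ_ne_zero]
        linarith
    have htel : ∑ n ∈ range N, (w n ^ (k + 1) - w (n + 1) ^ (k + 1)) ≤
        (Real.log N + (k + 1 : ℕ)) ^ (k + 1) := by
      rw [sum_range_sub']
      have h0 : w 0 = Real.log N + (k + 1 : ℕ) := by simp [hw]
      rw [h0]
      have := pow_nonneg (hw_nonneg N le_rfl) (k + 1)
      linarith
    refine le_trans ?_ (div_le_div_of_nonneg_right htel (Nat.cast_nonneg _))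
    rw [Nat.factorial_succ, sum_div, sum_Ioc_zero_eq_sum_range]
    refine sum_le_sum fun n hn => ?_
    have hn : n < N := mem_range.1 hn
    have hw₁ : 0 ≤ w (n + 1) := hw_nonneg _ hn
    have hpos : 0 < N / (n + 1) := Nat.div_pos hn (by omega)
    have hlog : Real.log (N / (n + 1) : ℕ) + k ≤ w (n + 1) := by
      simp only [hw, Nat.succ_ne_zero, if_false]
      rw [← Real.log_div (by positivity) (by positivity)]
      gcongr
      exact Nat.cast_div_le
    have hw₂ : 0 ≤ w n - w (n + 1) := le_trans (by positivity) (hdiff n)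
    calc 1 / ((n + 1 : ℕ) : ℝ) *
          ∑ m ∈ Ioc 0 (N / (n + 1)), ((ζ : ArithmeticFunction ℝ) ^ k).divSelf m
        ≤ 1 / ((n + 1 : ℕ) : ℝ) * (w (n + 1) ^ k / k.factorial) := by
          gcongr
          refine (ih _ hpos).trans ?_
          have := Real.log_natCast_nonneg (N / (n + 1))
          gcongr
      _ ≤ (w n - w (n + 1)) * (w (n + 1) ^ k / k.factorial) := by
          gcongr
          exact hdiff n
      _ = ((k + 1) * w (n + 1) ^ k * (w n - w (n + 1))) / ((k + 1) * k.factorial : ℕ) := by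
          push_cast; field_simp
      _ ≤ _ := by
          gcongr
          exact le_pow_succ_sub hw₁ (by linarith) k

lemma moebius_mul_apply_prime_pow_succ (f : ArithmeticFunction ℝ) {p : ℕ} (hp : p.Prime) (k : ℕ) :
    ((μ : ArithmeticFunction ℝ) * f) (p ^ (k + 1)) = f (p ^ (k + 1)) - f (p ^ k) := by
  have h (j : ℕ) : f (p ^ j) = ∑ i ∈ range (j + 1), ((μ : ArithmeticFunction ℝ) * f) (p ^ i) := by
    rw [← Nat.sum_divisors_prime_pow hp, ← coe_zeta_mul_apply, ← mul_assoc,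
      coe_zeta_mul_coe_moebius, one_mul]
  rw [h (k + 1), h k, sum_range_succ]
  ring

lemma moebius_mul_apply_pow_zero (f : ArithmeticFunction ℝ) (p : ℕ) :
    ((μ : ArithmeticFunction ℝ) * f) (p ^ 0) = f (p ^ 0) := by
  simp

/-- The arithmetic function `n ↦ ∏_{p ∣ n} (1 - 1 / p ^ s)`. -/
noncomputable def jordanDensity (s : ℕ) : ArithmeticFunction ℝ :=
  prodPrimeFactors fun p => 1 - 1 / (p : ℝ) ^ s

lemma jordanTotient_div_pow_succ (s : ℕ) {n : ℕ} (hn : n ≠ 0) :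
    jordanTotient s n / (n : ℝ) ^ (s + 1) = jordanDensity s n / n := by
  have : (n : ℝ) ≠ 0 := by exact_mod_cast hn
  rw [jordanTotient, jordanDensity, prodPrimeFactors_apply hn]
  field_simp
  ring

lemma jordanDensity_prime_pow_succ (s : ℕ) {p : ℕ} (hp : p.Prime) (k : ℕ) :
    jordanDensity s (p ^ (k + 1)) = 1 - 1 / (p : ℝ) ^ s := by
  rw [jordanDensity, prodPrimeFactors_apply (pow_ne_zero _ hp.ne_zero),
    Nat.primeFactors_prime_pow (Nat.succ_ne_zero k) hp, prod_singleton]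

lemma zeta_mul_jordanDensity_prime_pow (s : ℕ) {p : ℕ} (hp : p.Prime) (k : ℕ) :
    ((ζ : ArithmeticFunction ℝ) * jordanDensity s) (p ^ k) = 1 + k * (1 - 1 / (p : ℝ) ^ s) := by
  rw [coe_zeta_mul_apply, Nat.sum_divisors_prime_pow hp, sum_range_succ']
  simp only [jordanDensity_prime_pow_succ s hp, sum_const, card_range, nsmul_eq_mul, pow_zero]
  rw [jordanDensity, (IsMultiplicative.prodPrimeFactors _).map_one, add_comm]

/-- The pointwise square of `ζ * jordanDensity s`. -/
noncomputable def jordanSq (s : ℕ) : ArithmeticFunction ℝ :=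
  pmul ((ζ : ArithmeticFunction ℝ) * jordanDensity s) ((ζ : ArithmeticFunction ℝ) * jordanDensity s)

lemma isMultiplicative_jordanSq (s : ℕ) : (jordanSq s).IsMultiplicative := by
  have h : ((ζ : ArithmeticFunction ℝ) * jordanDensity s).IsMultiplicative :=
    isMultiplicative_zeta.natCast.mul (IsMultiplicative.prodPrimeFactors _)
  exact h.pmul h

/-- The convolution of `jordanDensity s` with itself with respect to the least common multiple. -/
noncomputable def jordanLcm (s : ℕ) : ArithmeticFunction ℝ where
  toFun n := ∑ x ∈ n.divisors ×ˢ n.divisors with Nat.lcm x.1 x.2 = n,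
    jordanDensity s x.1 * jordanDensity s x.2
  map_zero' := by simp

lemma jordanLcm_apply (s n : ℕ) :
    jordanLcm s n = ∑ x ∈ n.divisors ×ˢ n.divisors with Nat.lcm x.1 x.2 = n,
      jordanDensity s x.1 * jordanDensity s x.2 := rfl

lemma zeta_mul_jordanLcm (s : ℕ) : (ζ : ArithmeticFunction ℝ) * jordanLcm s = jordanSq s := by
  ext n
  rcases eq_or_ne n 0 with rfl | hn
  · simp
  rw [coe_zeta_mul_apply, jordanSq, pmul_apply, coe_zeta_mul_apply, sum_mul_sum, ← sum_product',
    ← sum_fiberwise_of_maps_to (g := fun x : ℕ × ℕ => Nat.lcm x.1 x.2) (t := n.divisors)]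
  · refine sum_congr rfl fun m hm => ?_
    have hm' := Nat.mem_divisors.1 hm
    rw [jordanLcm_apply]
    refine sum_congr ?_ fun _ _ => rfl
    ext ⟨i, j⟩
    simp only [mem_filter, mem_product, Nat.mem_divisors]
    constructor
    · rintro ⟨⟨⟨h₁, _⟩, h₂, _⟩, h⟩
      exact ⟨⟨⟨h₁.trans hm'.1, hn⟩, h₂.trans hm'.1, hn⟩, h⟩
    · rintro ⟨_, rfl⟩
      exact ⟨⟨⟨Nat.dvd_lcm_left i j, ne_zero_of_dvd_ne_zero hn hm'.1⟩,
        Nat.dvd_lcm_right i j, ne_zero_of_dvd_ne_zero hn hm'.1⟩, rfl⟩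
  · rintro ⟨i, j⟩ h
    simp only [mem_product, Nat.mem_divisors] at h ⊢
    exact ⟨Nat.lcm_dvd h.1.1 h.2.1, hn⟩

lemma sum_jordanTotient_gcd_eq (s N : ℕ) :
    ∑ p ∈ (Icc 1 N ×ˢ Icc 1 N).filter (fun p => Nat.lcm p.1 p.2 ≤ N),
      jordanTotient s p.1 / (p.1 : ℝ) ^ (s + 1) *
        (jordanTotient s p.2 / (p.2 : ℝ) ^ (s + 1)) * (Nat.gcd p.1 p.2 : ℝ) =
      ∑ n ∈ Ioc 0 N, (jordanLcm s).divSelf n := by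
  rw [← sum_fiberwise_of_maps_to (g := fun x : ℕ × ℕ => Nat.lcm x.1 x.2) (t := Ioc 0 N)]
  · refine sum_congr rfl fun n hn => ?_
    have hn' := mem_Ioc.1 hn
    rw [divSelf_apply, jordanLcm_apply, sum_div]
    refine sum_congr ?_ ?_
    · ext ⟨i, j⟩
      simp only [mem_filter, mem_product, Nat.mem_divisors, mem_Icc]
      constructor
      · rintro ⟨_, rfl⟩
        exact ⟨⟨⟨Nat.dvd_lcm_left i j, hn'.1.ne'⟩, Nat.dvd_lcm_right i j, hn'.1.ne'⟩, rfl⟩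
      · rintro ⟨⟨⟨h₁, _⟩, h₂, _⟩, h⟩
        have := Nat.le_of_dvd hn'.1 h₁
        have := Nat.le_of_dvd hn'.1 h₂
        have := Nat.pos_of_dvd_of_pos h₁ hn'.1
        have := Nat.pos_of_dvd_of_pos h₂ hn'.1
        exact ⟨⟨⟨by omega, by omega⟩, by omega⟩, h⟩
    · rintro ⟨i, j⟩ h
      simp only [mem_filter, mem_product, Nat.mem_divisors] at h
      obtain ⟨⟨⟨h₁, _⟩, h₂, _⟩, h⟩ := h
      have hi := (Nat.pos_of_dvd_of_pos h₁ hn'.1).ne'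
      have hj := (Nat.pos_of_dvd_of_pos h₂ hn'.1).ne'
      have hn₀ : (n : ℝ) ≠ 0 := by exact_mod_cast hn'.1.ne'
      have hi₀ : (i : ℝ) ≠ 0 := by exact_mod_cast hi
      have hj₀ : (j : ℝ) ≠ 0 := by exact_mod_cast hj
      have hgl : (Nat.gcd i j : ℝ) * n = i * j := by
        rw [← h]; exact_mod_cast Nat.gcd_mul_lcm i j
      rw [jordanTotient_div_pow_succ s hi, jordanTotient_div_pow_succ s hj]
      field_simp
      linear_combination jordanDensity s i * jordanDensity s j * hgl
  · rintro ⟨i, j⟩ h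
    simp only [mem_filter, mem_product, mem_Icc] at h
    exact mem_Ioc.2 ⟨Nat.lcm_pos h.1.1.1 h.1.2.1, h.2⟩

/-- The Dirichlet quotient of `jordanLcm s` by the ternary divisor function `ζ ^ 3`. -/
noncomputable def jordanCorrection (s : ℕ) : ArithmeticFunction ℝ :=
  (μ : ArithmeticFunction ℝ) * (μ * (μ * (μ * jordanSq s)))

lemma isMultiplicative_jordanCorrection (s : ℕ) : (jordanCorrection s).IsMultiplicative := by
  have h := isMultiplicative_moebius.intCast (R := ℝ)
  exact h.mul (h.mul (h.mul (h.mul (isMultiplicative_jordanSq s))))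

lemma jordanCorrection_mul_zeta_pow (s : ℕ) :
    jordanCorrection s * (ζ : ArithmeticFunction ℝ) ^ 3 = jordanLcm s := by
  have h : (μ : ArithmeticFunction ℝ) * ζ = 1 := coe_moebius_mul_coe_zeta
  rw [jordanCorrection, ← zeta_mul_jordanLcm]
  calc _ = ((μ : ArithmeticFunction ℝ) * ζ) ^ 4 * jordanLcm s := by ring
    _ = _ := by rw [h, one_pow, one_mul]

section PrimePowers

variable (s : ℕ) {p : ℕ} (hp : p.Prime)
include hp

lemma jordanSq_prime_pow (k : ℕ) :
    jordanSq s (p ^ k) = (1 + k * (1 - 1 / (p : ℝ) ^ s)) ^ 2 := by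
  rw [jordanSq, pmul_apply, zeta_mul_jordanDensity_prime_pow s hp, sq]

lemma jordanCorrection_prime_pow_one :
    jordanCorrection s (p ^ 1) = -4 * (1 / (p : ℝ) ^ s) + (1 / (p : ℝ) ^ s) ^ 2 := by
  rw [jordanCorrection, show p ^ 1 = p ^ (0 + 1) from rfl]
  simp only [moebius_mul_apply_prime_pow_succ _ hp, moebius_mul_apply_pow_zero,
    jordanSq_prime_pow s hp]
  push_cast
  ring

lemma jordanCorrection_prime_pow_two :
    jordanCorrection s (p ^ 2) = -1 + 4 * (1 / (p : ℝ) ^ s) := by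
  rw [jordanCorrection, show p ^ 2 = p ^ (0 + 1 + 1) from rfl]
  simp only [moebius_mul_apply_prime_pow_succ _ hp, moebius_mul_apply_pow_zero,
    jordanSq_prime_pow s hp]
  push_cast
  ring

lemma jordanCorrection_prime_pow_three :
    jordanCorrection s (p ^ 3) = -(1 / (p : ℝ) ^ s) ^ 2 := by
  rw [jordanCorrection, show p ^ 3 = p ^ (0 + 1 + 1 + 1) from rfl]
  simp only [moebius_mul_apply_prime_pow_succ _ hp, moebius_mul_apply_pow_zero,
    jordanSq_prime_pow s hp]
  push_cast
  ring

lemma jordanCorrection_prime_pow_of_four_le {k : ℕ} (hk : 4 ≤ k) :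
    jordanCorrection s (p ^ k) = 0 := by
  obtain ⟨j, rfl⟩ := Nat.exists_eq_add_of_le' hk
  rw [jordanCorrection, show j + 4 = j + 1 + 1 + 1 + 1 from rfl]
  simp only [moebius_mul_apply_prime_pow_succ _ hp, jordanSq_prime_pow s hp]
  push_cast
  ring

lemma divSelf_jordanCorrection_prime_pow_of_notMem {k : ℕ} (hk : k ∉ range 4) :
    (jordanCorrection s).divSelf (p ^ k) = 0 := by
  rw [divSelf_apply, jordanCorrection_prime_pow_of_four_le s hp (by simpa using hk), zero_div]

lemma tsum_divSelf_jordanCorrection_prime_pow :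
    ∑' k : ℕ, (jordanCorrection s).divSelf (p ^ k) =
      1 - 4 / (p : ℝ) ^ (s + 1) - 1 / (p : ℝ) ^ 2 + 4 / (p : ℝ) ^ (s + 2)
        + 1 / (p : ℝ) ^ (2 * s + 1) - 1 / (p : ℝ) ^ (2 * s + 3) := by
  have hp₀ : (p : ℝ) ≠ 0 := by exact_mod_cast hp.ne_zero
  rw [tsum_eq_sum fun k hk => divSelf_jordanCorrection_prime_pow_of_notMem s hp hk]
  simp only [sum_range_succ, range_zero, sum_empty, divSelf_apply,
    jordanCorrection_prime_pow_one s hp, jordanCorrection_prime_pow_two s hp,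
    jordanCorrection_prime_pow_three s hp, pow_zero,
    (isMultiplicative_jordanCorrection s).map_one]
  push_cast
  field_simp
  ring

lemma tsum_norm_divSelf_jordanCorrection_prime_pow_le (hs : 1 ≤ s) :
    ∑' k : ℕ, ‖(jordanCorrection s).divSelf (p ^ k)‖ ≤ 1 + 11 * ((p : ℝ) ^ 2)⁻¹ := by
  have hp₁ : (1 : ℝ) ≤ p := by exact_mod_cast hp.one_lt.le
  have hp₀ : (0 : ℝ) < p := by linarith
  rw [tsum_eq_sum fun k hk => by
    rw [divSelf_jordanCorrection_prime_pow_of_notMem s hp hk, norm_zero]]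
  simp only [sum_range_succ, range_zero, sum_empty, divSelf_apply,
    jordanCorrection_prime_pow_one s hp, jordanCorrection_prime_pow_two s hp,
    jordanCorrection_prime_pow_three s hp, pow_zero,
    (isMultiplicative_jordanCorrection s).map_one]
  have hy₀ : 0 ≤ 1 / (p : ℝ) ^ s := by positivity
  have hyx : 1 / (p : ℝ) ^ s ≤ 1 / p := by
    gcongr
    exact le_self_pow₀ hp₁ (by omega)
  have hx : 1 / (p : ℝ) ≤ 1 := by rw [div_le_one hp₀]; exact hp₁
  push_cast
  rw [pow_one, ← inv_pow]
  simp only [div_eq_mul_inv _ (p : ℝ), div_eq_mul_inv _ ((p : ℝ) ^ 2),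
    div_eq_mul_inv _ ((p : ℝ) ^ 3), norm_mul, Real.norm_eq_abs, ← inv_pow]
  rw [one_div (p : ℝ)] at hx hyx
  set x : ℝ := (p : ℝ)⁻¹
  set y : ℝ := 1 / (p : ℝ) ^ s
  have hx₀ : 0 ≤ x := hy₀.trans hyx
  have h₁ : |-4 * y + y ^ 2| ≤ 5 * x := abs_le.2 ⟨by nlinarith, by nlinarith⟩
  have h₂ : |-1 + 4 * y| ≤ 5 := abs_le.2 ⟨by linarith, by linarith⟩
  have h₃ : |-y ^ 2| ≤ 1 := abs_le.2 ⟨by nlinarith, by nlinarith⟩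
  rw [abs_of_nonneg hx₀, abs_of_nonneg (pow_nonneg hx₀ 2), abs_of_nonneg (pow_nonneg hx₀ 3)]
  have e₁ := mul_le_mul_of_nonneg_right h₁ hx₀
  have e₂ := mul_le_mul_of_nonneg_right h₂ (pow_nonneg hx₀ 2)
  have e₃ := mul_le_mul_of_nonneg_right h₃ (pow_nonneg hx₀ 3)
  have e₄ : x ^ 3 ≤ x ^ 2 := pow_le_pow_of_le_one hx₀ hx (by norm_num)
  rw [abs_of_nonneg (by norm_num)]
  norm_num only
  linarith

end PrimePowers

lemma summable_norm_divSelf_jordanCorrection {s : ℕ} (hs : 1 ≤ s) :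
    Summable fun n => ‖(jordanCorrection s).divSelf n‖ := by
  refine (isMultiplicative_jordanCorrection s).divSelf.summable_norm_of_tsum_prime_pow_le
    (g := fun n => 11 * ((n : ℝ) ^ 2)⁻¹)
    ((Real.summable_nat_pow_inv.2 one_lt_two).mul_left 11) (fun _ => by positivity)
    (fun {p} hp => ?_) fun p hp => tsum_norm_divSelf_jordanCorrection_prime_pow_le s hp hs
  refine summable_of_ne_finset_zero (s := range 4) fun k hk => ?_
  rw [divSelf_jordanCorrection_prime_pow_of_notMem s hp hk, norm_zero]

lemma tsum_divSelf_jordanCorrection {s : ℕ} (hs : 1 ≤ s) :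
    ∑' n, (jordanCorrection s).divSelf n = 12 * DeltaS s := by
  rw [← (isMultiplicative_jordanCorrection s).divSelf.eulerProduct_tprod
    (summable_norm_divSelf_jordanCorrection hs), DeltaS, ← mul_assoc,
    mul_one_div_cancel (by norm_num), one_mul]
  exact tprod_congr fun p => tsum_divSelf_jordanCorrection_prime_pow s p.2

lemma tendsto_log_natCast_add_const_pow_div (c : ℝ) (k : ℕ) :
    Tendsto (fun N : ℕ => (Real.log N + c) ^ k / k.factorial / Real.log N ^ k) atTop
      (𝓝 (1 / k.factorial)) := by
  have hlog : Tendsto (fun N : ℕ => Real.log N) atTop atTop :=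
    Real.tendsto_log_atTop.comp tendsto_natCast_atTop_atTop
  have h : Tendsto (fun N : ℕ => (1 + c / Real.log N) ^ k / k.factorial) atTop
      (𝓝 ((1 + 0) ^ k / k.factorial)) :=
    ((tendsto_const_nhds.add (tendsto_const_nhds.div_atTop hlog)).pow k).div_const _
  rw [add_zero, one_pow] at h
  refine h.congr' ?_
  filter_upwards [hlog.eventually_gt_atTop 0] with N hN
  rw [div_right_comm, ← div_pow, add_div, div_self hN.ne']

lemma tendsto_sum_divSelf_zeta_pow_div {m : ℕ} (hm : 0 < m) (k : ℕ) :
    Tendsto (fun N : ℕ => (∑ n ∈ Ioc 0 (N / m), ((ζ : ArithmeticFunction ℝ) ^ k).divSelf n) /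
      Real.log N ^ k) atTop (𝓝 (1 / k.factorial)) := by
  refine tendsto_of_tendsto_of_tendsto_of_le_of_le'
    (tendsto_log_natCast_add_const_pow_div (-Real.log m) k)
    (tendsto_log_natCast_add_const_pow_div k k) ?_ ?_
  · filter_upwards [eventually_ge_atTop m] with N hN
    have hN₀ : 0 < N := hm.trans_le hN
    have hlogN := Real.log_natCast_nonneg N
    refine div_le_div_of_nonneg_right ?_ (by positivity)
    refine le_trans ?_ (log_pow_le_sum_divSelf_zeta_pow k _ (Nat.div_pos hN hm))
    have h₀ : 0 ≤ Real.log N + -Real.log m := by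
      have := Real.log_le_log (x := m) (y := N) (by exact_mod_cast hm) (by exact_mod_cast hN)
      linarith
    gcongr
    rw [← sub_eq_add_neg, ← Real.log_div (by positivity) (by positivity)]
    refine Real.log_le_log (by positivity) ?_
    rw [div_le_iff₀ (by positivity)]
    have := (Nat.lt_mul_div_succ N hm).le
    rw [mul_comm] at this
    exact_mod_cast this
  · filter_upwards [eventually_ge_atTop m] with N hN
    have hlogN := Real.log_natCast_nonneg N
    have hpos := Nat.div_pos hN hm
    have := Real.log_natCast_nonneg (N / m)
    refine div_le_div_of_nonneg_right ?_ (by positivity)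
    refine (sum_divSelf_zeta_pow_le k _ hpos).trans ?_
    gcongr
    exact Nat.div_le_self N m

lemma divSelf_zeta_pow_nonneg (k n : ℕ) : 0 ≤ ((ζ : ArithmeticFunction ℝ) ^ k).divSelf n := by
  rw [divSelf_apply]
  refine div_nonneg ?_ n.cast_nonneg
  induction k generalizing n with
  | zero => rw [pow_zero, one_apply]; positivity
  | succ k ih =>
    rw [pow_succ', coe_zeta_mul_apply]
    exact sum_nonneg fun i _ => ih i

lemma sum_divSelf_zeta_pow_div_le {N : ℕ} (hN : 1 ≤ Real.log N) (m k : ℕ) :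
    (∑ n ∈ Ioc 0 (N / m), ((ζ : ArithmeticFunction ℝ) ^ k).divSelf n) / Real.log N ^ k ≤
      (1 + k) ^ k := by
  have hN₀ : 0 < N := Nat.pos_of_ne_zero fun h => by norm_num [h] at hN
  rw [div_le_iff₀ (by positivity), ← mul_pow]
  calc _ ≤ ∑ n ∈ Ioc 0 N, ((ζ : ArithmeticFunction ℝ) ^ k).divSelf n :=
        sum_le_sum_of_subset_of_nonneg (Ioc_subset_Ioc_right (Nat.div_le_self N m))
          fun n _ _ => divSelf_zeta_pow_nonneg k n
    _ ≤ (Real.log N + k) ^ k / k.factorial := sum_divSelf_zeta_pow_le k N hN₀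
    _ ≤ (Real.log N + k) ^ k :=
        div_le_self (by positivity) (by exact_mod_cast k.factorial_pos)
    _ ≤ _ := by
        gcongr
        nlinarith [k.cast_nonneg (α := ℝ)]

lemma tendsto_sum_divSelf_mul_zeta_pow {f : ArithmeticFunction ℝ}
    (hf : Summable fun n => ‖f.divSelf n‖) (k : ℕ) :
    Tendsto (fun N : ℕ => 1 / Real.log N ^ k *
      ∑ n ∈ Ioc 0 N, (f * (ζ : ArithmeticFunction ℝ) ^ k).divSelf n) atTop
      (𝓝 ((∑' n, f.divSelf n) * (1 / k.factorial))) := by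
  rw [← tsum_mul_right]
  set S : ℕ → ℝ := fun M => ∑ n ∈ Ioc 0 M, ((ζ : ArithmeticFunction ℝ) ^ k).divSelf n with hS
  have hlog : Tendsto (fun N : ℕ => Real.log N) atTop atTop :=
    Real.tendsto_log_atTop.comp tendsto_natCast_atTop_atTop
  have key : Tendsto (fun N : ℕ => ∑' m, f.divSelf m * (S (N / m) / Real.log N ^ k)) atTop
      (𝓝 (∑' m, f.divSelf m * (1 / k.factorial))) := by
    refine tendsto_tsum_of_dominated_convergence (hf.mul_right ((1 + k : ℝ) ^ k)) (fun m => ?_) ?_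
    · rcases Nat.eq_zero_or_pos m with rfl | hm
      · simp
      · exact (tendsto_sum_divSelf_zeta_pow_div hm k).const_mul _
    · filter_upwards [hlog.eventually_ge_atTop 1] with N hN m
      have h₀ : 0 ≤ S (N / m) / Real.log N ^ k :=
        div_nonneg (sum_nonneg fun n _ => divSelf_zeta_pow_nonneg k n) (by positivity)
      rw [norm_mul, Real.norm_of_nonneg h₀]
      exact mul_le_mul_of_nonneg_left (sum_divSelf_zeta_pow_div_le hN m k) (norm_nonneg _)
  refine key.congr fun N => ?_
  rw [divSelf_mul, sum_Ioc_mul_eq_sum_sum, mul_sum, tsum_eq_sum (s := Ioc 0 N)]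
  · refine sum_congr rfl fun m _ => ?_
    rw [hS]
    ring
  · intro m hm
    rcases Nat.eq_zero_or_pos m with rfl | hm₀
    · simp
    · have : N / m = 0 := Nat.div_eq_of_lt (by simp at hm; omega)
      simp [hS, this]

lemma tendsto_sum_jordanTotient_gcd {s : ℕ} (hs : 1 ≤ s) :
    Tendsto (fun N : ℕ => 1 / Real.log N ^ 3 *
      ∑ p ∈ (Icc 1 N ×ˢ Icc 1 N).filter (fun p => Nat.lcm p.1 p.2 ≤ N),
        jordanTotient s p.1 / (p.1 : ℝ) ^ (s + 1) *
          (jordanTotient s p.2 / (p.2 : ℝ) ^ (s + 1)) * (Nat.gcd p.1 p.2 : ℝ)) atTop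
      (𝓝 (2 * DeltaS s)) := by
  have h := tendsto_sum_divSelf_mul_zeta_pow (summable_norm_divSelf_jordanCorrection hs) 3
  rw [jordanCorrection_mul_zeta_pow, tsum_divSelf_jordanCorrection hs] at h
  convert h using 2
  · rw [sum_jordanTotient_gcd_eq]
  · norm_num [Nat.factorial]
    ring

lemma jordanTotient_nonneg (s k : ℕ) : 0 ≤ jordanTotient s k := by
  refine mul_nonneg (by positivity) (prod_nonneg fun p hp => sub_nonneg.2 ?_)
  have : (1 : ℝ) ≤ p := by exact_mod_cast (Nat.prime_of_mem_primeFactors hp).one_lt.le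
  exact div_le_one_of_le₀ (one_le_pow₀ this) (by positivity)

lemma DeltaS_nonneg {s : ℕ} (hs : 1 ≤ s) : 0 ≤ DeltaS s := by
  have h := ge_of_tendsto' (tendsto_sum_jordanTotient_gcd hs) (b := 0) fun N => by
    have := Real.log_natCast_nonneg N
    refine mul_nonneg (by positivity) (sum_nonneg fun p _ => ?_)
    have := jordanTotient_nonneg s p.1
    have := jordanTotient_nonneg s p.2
    positivity
  linarith

end ArithmeticFunction
end Helpers

/-- For each integer `s ≥ 1`,
`liminf_{N→∞} (ln N)⁻³ Σ_{lcm(i,j) ≤ N} (φ_s(i)/i^{s+1})(φ_s(j)/j^{s+1}) gcd(i,j) ≥ Δ_s`. -/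
theorem liminf_sum_jordanTotient_gcd (s : ℕ) (hs : 1 ≤ s) :
    DeltaS s ≤ liminf (fun N : ℕ =>
        (1 / Real.log N ^ 3) *
          ∑ p ∈ (Finset.Icc 1 N ×ˢ Finset.Icc 1 N).filter (fun p => Nat.lcm p.1 p.2 ≤ N),
            jordanTotient s p.1 / (p.1 : ℝ) ^ (s + 1) *
              (jordanTotient s p.2 / (p.2 : ℝ) ^ (s + 1)) * (Nat.gcd p.1 p.2 : ℝ)) atTop := by
  rw [(ArithmeticFunction.tendsto_sum_jordanTotient_gcd hs).liminf_eq]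
  linarith [ArithmeticFunction.DeltaS_nonneg hs]
end

section
/- (Schur's constants.) For all integers s ≥ 1 and l ≥ 1, the limit S_l^{(s)} := lim_{n→∞} (1/n)·Σ_{k=1}^n (φ_s(k)/k^s)^l exists and equals Π_p (1 − (1/p)·[1 − (1 − 1/p^s)^l]), the product over all primes p. -/
open Filter

theorem tendsto_natCast_div_div_atTop (d : ℕ) :
    Tendsto (fun n : ℕ => ((n / d : ℕ) : ℝ) / (n : ℝ)) atTop (nhds ((d : ℝ)⁻¹)) := by
  refine ((tendsto_nat_floor_mul_div_atTop (R := ℝ) (a := (d : ℝ)⁻¹)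
    (by positivity)).comp tendsto_natCast_atTop_atTop).congr fun n => ?_
  simp only [Function.comp_apply]
  rw [← Nat.floor_div_eq_div (K := ℝ) n d, inv_mul_eq_div]

theorem Finset.prod_primes_dvd_iff (S : Finset {p : ℕ // p.Prime}) {k : ℕ} (hk : k ≠ 0) :
    ∏ p ∈ S, (p : ℕ) ∣ k ↔ S ⊆ k.primeFactors.subtype Nat.Prime := by
  refine ⟨fun h p hp => ?_, fun h => ?_⟩
  · rw [Finset.mem_subtype, Nat.mem_primeFactors]
    exact ⟨p.2, (Finset.dvd_prod_of_mem _ hp).trans h, hk⟩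
  · change ∏ p ∈ S, id ((⟨_, Subtype.val_injective⟩ : {p : ℕ // p.Prime} ↪ ℕ) p) ∣ k
    rw [← Finset.prod_map]
    refine Finset.prod_primes_dvd k (fun q hq => ?_) fun q hq => ?_
    · obtain ⟨p, -, rfl⟩ := Finset.mem_map.1 hq
      exact p.2.prime
    · obtain ⟨p, hp, rfl⟩ := Finset.mem_map.1 hq
      exact Nat.dvd_of_mem_primeFactors (Finset.mem_subtype.1 (h hp))

/-- A function `k ↦ ∏_{p ∣ k} (1 + b p)` with `∑ |b p| / p` convergent has mean value
`∏_p (1 + b p / p)`. -/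
theorem tendsto_mean_prod_primeFactors (b : ℕ → ℝ)
    (hb : Summable fun p : {p : ℕ // p.Prime} => b p / (p : ℕ)) :
    Tendsto (fun n : ℕ =>
        (∑ k ∈ Finset.Icc 1 n, ∏ p ∈ k.primeFactors, (1 + b p)) / (n : ℝ))
      atTop (nhds (∏' p : {p : ℕ // p.Prime}, (1 + b p / (p : ℕ)))) := by
  have hnorm : Summable fun p : {p : ℕ // p.Prime} => ‖b p / (p : ℕ)‖ := hb.norm
  rw [tprod_one_add (summable_finsetProd_of_summable_norm hnorm)]
  have hprod (k : ℕ) : ∏ p ∈ k.primeFactors, (1 + b p) =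
      ∏ p ∈ k.primeFactors.subtype Nat.Prime, (1 + b (p : ℕ)) :=
    (Finset.prod_subtype_of_mem (fun p => 1 + b p)
      fun _ => Nat.prime_of_mem_primeFactors).symm
  have hsum (n : ℕ) : (∑ k ∈ Finset.Icc 1 n, ∏ p ∈ k.primeFactors, (1 + b p)) / (n : ℝ) =
      ∑' S : Finset {p : ℕ // p.Prime},
        (∏ p ∈ S, b p) * (((n / ∏ p ∈ S, (p : ℕ) : ℕ) : ℝ) / (n : ℝ)) := by
    have hk (k : ℕ) (hk : k ∈ Finset.Icc 1 n) :
        HasSum (fun S : Finset {p : ℕ // p.Prime} =>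
            if ∏ p ∈ S, (p : ℕ) ∣ k then ∏ p ∈ S, b p else 0)
          (∏ p ∈ k.primeFactors, (1 + b p)) := by
      have hk0 : k ≠ 0 := by grind
      simp_rw [hprod, Finset.prod_one_add, Finset.prod_primes_dvd_iff _ hk0]
      rw [Finset.sum_congr rfl (g := fun S : Finset {p : ℕ // p.Prime} =>
        if S ⊆ k.primeFactors.subtype Nat.Prime then ∏ p ∈ S, b p else 0)
        fun S hS => (if_pos (Finset.mem_powerset.1 hS)).symm]
      exact hasSum_sum_of_ne_finset_zero fun S hS => if_neg (by simpa using hS)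
    rw [← ((hasSum_sum hk).div_const (n : ℝ)).tsum_eq]
    refine tsum_congr fun S => ?_
    rw [← Finset.sum_filter, Finset.sum_const, nsmul_eq_mul,
      show Finset.Icc 1 n = Finset.Ioc 0 n from rfl, Nat.Ioc_filter_dvd_card_eq_div]
    ring
  simp_rw [hsum]
  refine tendsto_tsum_of_dominated_convergence
    (bound := fun S : Finset {p : ℕ // p.Prime} => ∏ p ∈ S, ‖b p / (p : ℕ)‖)
    (summable_finsetProd_of_summable_nonneg (fun _ => norm_nonneg _) hnorm)
    (fun S => ?_) ?_
  · rw [Finset.prod_div_distrib, ← Nat.cast_prod, div_eq_mul_inv]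
    exact (tendsto_natCast_div_div_atTop (∏ p ∈ S, (p : ℕ))).const_mul (∏ p ∈ S, b p)
  · refine Eventually.of_forall fun n S => ?_
    rw [← norm_prod, Finset.prod_div_distrib, ← Nat.cast_prod, norm_mul,
      div_eq_mul_inv (∏ p ∈ S, b p), norm_mul]
    refine mul_le_mul_of_nonneg_left ?_ (norm_nonneg _)
    rw [Real.norm_of_nonneg (by positivity), Real.norm_of_nonneg (by positivity)]
    refine div_le_of_le_mul₀ (by positivity) (by positivity) ?_
    rw [inv_mul_eq_div]
    exact Nat.cast_div_le

theorem summable_one_sub_one_div_pow_pow_sub_one_div {s : ℕ} (hs : 1 ≤ s) (l : ℕ) :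
    Summable fun p : {p : ℕ // p.Prime} =>
      ((1 - 1 / ((p : ℕ) : ℝ) ^ s) ^ l - 1) / ((p : ℕ) : ℝ) := by
  have hsq : Summable fun p : {p : ℕ // p.Prime} => (l : ℝ) * (1 / ((p : ℕ) : ℝ) ^ 2) :=
    ((Real.summable_one_div_nat_pow.2 one_lt_two).comp_injective
      Subtype.val_injective).mul_left _
  refine hsq.of_norm_bounded fun p => ?_
  have hp : (1 : ℝ) ≤ (p : ℕ) := by exact_mod_cast p.2.one_lt.le
  have hinv : 1 / ((p : ℕ) : ℝ) ^ s ≤ 1 / (p : ℕ) :=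
    one_div_le_one_div_of_le (by positivity) (le_self_pow₀ hp (by lia))
  have hone : 1 / ((p : ℕ) : ℝ) ≤ 1 := (div_le_one (by positivity)).2 hp
  have hnonneg : 0 ≤ 1 / ((p : ℕ) : ℝ) ^ s := by positivity
  have hbern := one_add_mul_le_pow (a := -(1 / ((p : ℕ) : ℝ) ^ s)) (by linarith) l
  rw [← sub_eq_add_neg] at hbern
  have hpow : (1 - 1 / ((p : ℕ) : ℝ) ^ s) ^ l ≤ 1 :=
    pow_le_one₀ (by linarith) (by linarith)
  rw [norm_div, Real.norm_of_nonneg (Nat.cast_nonneg _), Real.norm_of_nonpos (by linarith),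
    div_le_iff₀ (by positivity)]
  calc -((1 - 1 / ((p : ℕ) : ℝ) ^ s) ^ l - 1) ≤ l * (1 / ((p : ℕ) : ℝ) ^ s) := by linarith
    _ ≤ l * (1 / (p : ℕ)) := by gcongr
    _ = l * (1 / ((p : ℕ) : ℝ) ^ 2) * (p : ℕ) := by field_simp

/-- **Schur's constants.** For all integers `s ≥ 1` and `l ≥ 1`,
`(1/n) Σ_{k=1}^n (φ_s(k)/k^s)^l` converges, as `n → ∞`, to
`Π_p (1 − (1/p)(1 − (1 − 1/p^s)^l))`. -/
theorem schur_constants (s l : ℕ) (hs : 1 ≤ s) (hl : 1 ≤ l) :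
    Tendsto (fun n : ℕ =>
        (1 / (n : ℝ)) * ∑ k ∈ Finset.Icc 1 n, (jordanTotient s k / (k : ℝ) ^ s) ^ l)
      atTop
      (nhds (∏' p : Nat.Primes,
        (1 - (1 / ((p : ℕ) : ℝ)) * (1 - (1 - 1 / ((p : ℕ) : ℝ) ^ s) ^ l)))) := by
  have h := tendsto_mean_prod_primeFactors
    (fun p => (1 - 1 / (p : ℝ) ^ s) ^ l - 1) (summable_one_sub_one_div_pow_pow_sub_one_div hs l)
  refine (h.congr fun n => ?_).trans_eq ?_
  · rw [div_eq_inv_mul, ← one_div]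
    congr 1
    refine Finset.sum_congr rfl fun k hk => ?_
    have hk0 : (k : ℝ) ^ s ≠ 0 := pow_ne_zero _ (Nat.cast_ne_zero.2 (by grind))
    rw [jordanTotient, mul_div_cancel_left₀ _ hk0, ← Finset.prod_pow]
    simp
  · congr 1
    exact tprod_congr fun p => by ring
end

section
/- Let P(k) = Σ_{j=1}^k gcd(j,k) be Pillai's function and, for an integer s ≥ 2, let P_s(k) = Σ_{i=1}^k gcd(i,k)^s. Then, as n → ∞: (a) (1/n)·Σ_{k=1}^n P(k)/k ∼ (1/ζ(2))·ln(n); and (b) for each fixed s ≥ 2, lim_{n→∞} (1/n)·Σ_{k=1}^n P_s(k)/k^s = ζ(s)/ζ(s+1). -/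
open Filter

/-- Pillai's function `P(k) = Σ_{j=1}^k gcd(j,k)`. -/
def pillai (k : ℕ) : ℕ := ∑ j ∈ Finset.Icc 1 k, Nat.gcd j k

/-- The generalized Pillai function `P_s(k) = Σ_{i=1}^k gcd(i,k)^s`. -/
def pillaiPow (s k : ℕ) : ℕ := ∑ i ∈ Finset.Icc 1 k, Nat.gcd i k ^ s

open Finset in
/-- Grouping the terms of `P_s(k)` by the value of the gcd. -/
theorem pillaiPow_eq_sum_divisorsAntidiagonal (s k : ℕ) :
    pillaiPow s k = ∑ p ∈ k.divisorsAntidiagonal, Nat.totient p.1 * p.2 ^ s := by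
  rcases Nat.eq_zero_or_pos k with rfl | hk
  · simp [pillaiPow]
  have hrange : pillaiPow s k = ∑ i ∈ range k, Nat.gcd k i ^ s := by
    obtain ⟨m, rfl⟩ : ∃ m, k = m + 1 := ⟨k - 1, by omega⟩
    rw [pillaiPow, sum_range_succ', sum_Icc_succ_top (by omega), Nat.gcd_self, Nat.gcd_zero_right,
      range_eq_Ico, sum_Ico_add' (fun i => Nat.gcd (m + 1) i ^ s) 0 m 1]
    exact congrArg (· + _) (sum_congr rfl fun i _ => by rw [Nat.gcd_comm])
  rw [hrange, Nat.sum_divisorsAntidiagonal' fun x y => Nat.totient x * y ^ s,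
    ← sum_fiberwise_of_maps_to (g := fun i => Nat.gcd k i) (t := k.divisors)
      fun i _ => Nat.mem_divisors.2 ⟨Nat.gcd_dvd_left k i, hk.ne'⟩]
  refine sum_congr rfl fun d hd => ?_
  rw [Nat.totient_div_of_dvd (Nat.dvd_of_mem_divisors hd), ← smul_eq_mul]
  exact sum_eq_card_nsmul fun i hi => by rw [(mem_filter.1 hi).2]

open Finset in
/-- Rearranging the summatory function of a Dirichlet convolution. -/
theorem sum_Icc_sum_divisorsAntidiagonal (f g : ℕ → ℝ) (N : ℕ) :
    ∑ n ∈ Icc 1 N, ∑ p ∈ n.divisorsAntidiagonal, f p.1 * g p.2 =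
      ∑ n ∈ Icc 1 N, f n * ∑ m ∈ Icc 1 (N / n), g m := by
  have h := ArithmeticFunction.sum_Ioc_mul_eq_sum_sum (toArithmeticFunction f)
    (toArithmeticFunction g) N
  have hI (M : ℕ) : Ioc 0 M = Icc 1 M := rfl
  simp only [hI] at h
  convert h using 2 with n hn n hn
  · rw [← congrFun (LSeries.convolution_def f g) n]
    rfl
  · have : n ≠ 0 := by have := (mem_Icc.1 hn).1; omega
    simp only [toArithmeticFunction, ArithmeticFunction.coe_mk, this, if_false]
    congr 1
    refine sum_congr rfl fun m hm => ?_
    have : m ≠ 0 := by have := (mem_Icc.1 hm).1; omega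
    simp [this]

theorem totient_eq_sum_moebius_mul {n : ℕ} (hn : 0 < n) :
    (Nat.totient n : ℝ) =
      ∑ p ∈ n.divisorsAntidiagonal, (ArithmeticFunction.moebius p.1 : ℝ) * (p.2 : ℝ) :=
  (ArithmeticFunction.sum_eq_iff_sum_mul_moebius_eq (R := ℝ)
    (f := fun n => (Nat.totient n : ℝ)) (g := fun n => (n : ℝ))).1
    (fun n _ => by exact_mod_cast Nat.sum_totient n) n hn |>.symm

theorem ofReal_zetaReal_natCast {k : ℕ} (hk : 1 < k) :
    ((zetaReal k : ℝ) : ℂ) = riemannZeta k := by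
  rw [zeta_nat_eq_tsum_of_gt_one hk, zetaReal]
  have h : ∑' n : ℕ+, 1 / ((n : ℕ) : ℝ) ^ k = ∑' n : ℕ, 1 / (n : ℝ) ^ k :=
    tsum_pnat_eq_tsum_of_eq_zero (f := fun n : ℕ => 1 / (n : ℝ) ^ k) (by simp; omega)
  simp only [Real.rpow_natCast]
  rw [h]
  push_cast
  rfl

theorem zetaReal_natCast_ne_zero {k : ℕ} (hk : 1 < k) : zetaReal k ≠ 0 := by
  intro h
  have h1 := ofReal_zetaReal_natCast hk
  rw [h, Complex.ofReal_zero] at h1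
  exact riemannZeta_ne_zero_of_one_lt_re (by simpa using hk) h1.symm

/-- A real Dirichlet series at an integer point, seen as an `LSeries`. -/
theorem LSeriesHasSum_natCast_iff {f : ℕ → ℝ} {k : ℕ} (hk : k ≠ 0) {a : ℝ} :
    LSeriesHasSum (fun n => (f n : ℂ)) k a ↔ HasSum (fun n => f n / (n : ℝ) ^ k) a := by
  rw [LSeriesHasSum, ← Complex.hasSum_ofReal]
  congr! 2 with n
  rcases eq_or_ne n 0 with rfl | hn
  · simp [hk]
  · simp [LSeries.term_of_ne_zero hn]

theorem LSeriesHasSum_moebius_natCast {k : ℕ} (hk : 1 < k) :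
    LSeriesHasSum (fun n => ((ArithmeticFunction.moebius n : ℝ) : ℂ)) k
      ((1 / zetaReal k : ℝ) : ℂ) := by
  have hre : 1 < ((k : ℂ)).re := by simpa using hk
  have h := (ArithmeticFunction.LSeriesSummable_moebius_iff.2 hre).LSeriesHasSum
  have h1 := ArithmeticFunction.LSeries_zeta_mul_Lseries_moebius hre
  rw [ArithmeticFunction.LSeries_zeta_eq_riemannZeta hre] at h1
  rw [Complex.ofReal_div, Complex.ofReal_one, ofReal_zetaReal_natCast hk,
    one_div, ← eq_inv_of_mul_eq_one_right h1]
  simpa using h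

theorem hasSum_moebius_div_pow {k : ℕ} (hk : 1 < k) :
    HasSum (fun n : ℕ => (ArithmeticFunction.moebius n : ℝ) / (n : ℝ) ^ k) (1 / zetaReal k) :=
  (LSeriesHasSum_natCast_iff (by omega)).1 (LSeriesHasSum_moebius_natCast hk)

theorem hasSum_totient_div_pow {s : ℕ} (hs : 1 < s) :
    HasSum (fun n : ℕ => (Nat.totient n : ℝ) / (n : ℝ) ^ (s + 1))
      (zetaReal s / zetaReal ((s : ℝ) + 1)) := by
  have hid : LSeriesHasSum (fun n => ((n : ℝ) : ℂ)) (s + 1 : ℕ) (zetaReal s : ℝ) := by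
    rw [LSeriesHasSum_natCast_iff (f := fun n => (n : ℝ)) (by omega)]
    have hsum : HasSum (fun n : ℕ => 1 / (n : ℝ) ^ s) (zetaReal s) := by
      rw [← Complex.hasSum_ofReal, ofReal_zetaReal_natCast hs, zeta_nat_eq_tsum_of_gt_one hs]
      have : Summable fun n : ℕ => ((1 / (n : ℝ) ^ s : ℝ) : ℂ) :=
        Complex.summable_ofReal.2 (Real.summable_one_div_nat_pow.2 hs)
      simpa using this.hasSum
    convert! hsum using 2 with n
    rcases eq_or_ne n 0 with rfl | hn
    · simp [show s ≠ 0 by omega]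
    · field_simp
      ring
  have h := (LSeriesHasSum_moebius_natCast (k := s + 1) (by omega)).convolution hid
  rw [← LSeriesHasSum_natCast_iff (by omega)]
  convert! h using 1
  · rw [LSeries.convolution_def]
    funext n
    rcases Nat.eq_zero_or_pos n with rfl | hn
    · simp
    · rw [totient_eq_sum_moebius_mul hn]
      push_cast
      rfl
  · push_cast
    ring

theorem tendsto_natDiv_div (e : ℕ) :
    Tendsto (fun n : ℕ => ((n / e : ℕ) : ℝ) / (n : ℝ)) atTop (nhds (1 / (e : ℝ))) := by
  have h := (tendsto_nat_floor_mul_div_atTop (R := ℝ) (a := (e : ℝ)⁻¹) (by positivity)).comp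
    tendsto_natCast_atTop_atTop
  simpa [Function.comp_def, ← Nat.floor_div_eq_div (K := ℝ), div_eq_inv_mul] using h

theorem natDiv_div_le (n e : ℕ) : ((n / e : ℕ) : ℝ) / (n : ℝ) ≤ 1 / (e : ℝ) := by
  rcases Nat.eq_zero_or_pos n with rfl | hn
  · simp
  rw [div_le_iff₀ (by positivity), one_div_mul_eq_div]
  exact Nat.cast_div_le

/-- The summatory function of `P_s(k)/k^s`, reorganised by divisors. -/
theorem sum_pillaiPow_div_pow (s n : ℕ) :
    ∑ k ∈ Finset.Icc 1 n, (pillaiPow s k : ℝ) / (k : ℝ) ^ s =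
      ∑ e ∈ Finset.Icc 1 n, (Nat.totient e : ℝ) / (e : ℝ) ^ s * ((n / e : ℕ) : ℝ) := by
  have h := sum_Icc_sum_divisorsAntidiagonal (fun e => (Nat.totient e : ℝ) / (e : ℝ) ^ s)
    (fun _ => 1) n
  simp only [mul_one, Finset.sum_const, Nat.card_Icc, Nat.add_sub_cancel, nsmul_eq_mul] at h
  rw [← h]
  refine Finset.sum_congr rfl fun k hk => ?_
  rw [pillaiPow_eq_sum_divisorsAntidiagonal, Nat.cast_sum, Finset.sum_div]
  refine Finset.sum_congr rfl fun p hp => ?_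
  obtain ⟨hp, hk0⟩ := Nat.mem_divisorsAntidiagonal.1 hp
  have h2 : (p.2 : ℝ) ≠ 0 := by
    rintro h0
    exact hk0 (by rw [← hp, Nat.cast_eq_zero.1 h0, mul_zero])
  rw [← hp]
  push_cast
  rw [mul_pow, mul_div_mul_right _ _ (pow_ne_zero s h2)]

/-- A sum over `[1, n]` is a sum over `ℕ` if the summand vanishes elsewhere. -/
theorem sum_Icc_one_eq_tsum {n : ℕ} {f : ℕ → ℝ} (h0 : f 0 = 0) (hf : ∀ e, n < e → f e = 0) :
    ∑ e ∈ Finset.Icc 1 n, f e = ∑' e, f e := by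
  refine (tsum_eq_sum fun e he => ?_).symm
  rcases Nat.eq_zero_or_pos e with rfl | h
  · exact h0
  · exact hf e (by by_contra! h'; exact he (Finset.mem_Icc.2 ⟨h, h'⟩))

theorem tendsto_mean_pillaiPow {s : ℕ} (hs : 2 ≤ s) :
    Tendsto (fun n : ℕ =>
        (1 / (n : ℝ)) * ∑ k ∈ Finset.Icc 1 n, (pillaiPow s k : ℝ) / (k : ℝ) ^ s)
      atTop (nhds (zetaReal s / zetaReal ((s : ℝ) + 1))) := by
  have hsum := hasSum_totient_div_pow (s := s) (by omega)
  have key : Tendsto (fun n : ℕ => ∑' e : ℕ, (Nat.totient e : ℝ) / (e : ℝ) ^ s *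
      (((n / e : ℕ) : ℝ) / (n : ℝ))) atTop
      (nhds (∑' e : ℕ, (Nat.totient e : ℝ) / (e : ℝ) ^ s * (1 / (e : ℝ)))) := by
    refine tendsto_tsum_of_dominated_convergence hsum.summable
      (fun e => (tendsto_natDiv_div e).const_mul _) (Eventually.of_forall fun n e => ?_)
    rw [Real.norm_of_nonneg (by positivity), pow_succ, ← div_div, div_eq_mul_one_div (_ / _)]
    exact mul_le_mul_of_nonneg_left (natDiv_div_le n e) (by positivity)
  have hlim : ∑' e : ℕ, (Nat.totient e : ℝ) / (e : ℝ) ^ s * (1 / (e : ℝ)) =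
      zetaReal s / zetaReal ((s : ℝ) + 1) := by
    rw [← hsum.tsum_eq]
    refine tsum_congr fun e => ?_
    rw [pow_succ, ← div_div, div_eq_mul_one_div (_ / _)]
  rw [hlim] at key
  refine key.congr fun n => ?_
  rw [sum_pillaiPow_div_pow, Finset.mul_sum, ← sum_Icc_one_eq_tsum (n := n) (by simp)
    fun e he => by simp [Nat.div_eq_of_lt he]]
  exact Finset.sum_congr rfl fun e _ => by ring

theorem sum_totient_div_sq (n : ℕ) :
    ∑ e ∈ Finset.Icc 1 n, (Nat.totient e : ℝ) / (e : ℝ) ^ 2 =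
      ∑ d ∈ Finset.Icc 1 n, (ArithmeticFunction.moebius d : ℝ) / (d : ℝ) ^ 2 *
        (harmonic (n / d) : ℝ) := by
  have h := sum_Icc_sum_divisorsAntidiagonal
    (fun d => (ArithmeticFunction.moebius d : ℝ) / (d : ℝ) ^ 2) (fun m => (m : ℝ)⁻¹) n
  simp only [harmonic_eq_sum_Icc]
  push_cast
  rw [← h]
  refine Finset.sum_congr rfl fun k hk => ?_
  rw [totient_eq_sum_moebius_mul (Finset.mem_Icc.1 hk).1, Finset.sum_div]
  refine Finset.sum_congr rfl fun p hp => ?_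
  obtain ⟨hp, hk0⟩ := Nat.mem_divisorsAntidiagonal.1 hp
  have h2 : (p.2 : ℝ) ≠ 0 := by
    rintro h0
    exact hk0 (by rw [← hp, Nat.cast_eq_zero.1 h0, mul_zero])
  have h1 : (p.1 : ℝ) ≠ 0 := by
    rintro h0
    exact hk0 (by rw [← hp, Nat.cast_eq_zero.1 h0, zero_mul])
  rw [← hp]
  push_cast
  field_simp

theorem tendsto_log_natCast_atTop : Tendsto (fun n : ℕ => Real.log n) atTop atTop :=
  Real.tendsto_log_atTop.comp tendsto_natCast_atTop_atTop

theorem harmonic_natDiv_le (n d : ℕ) : (harmonic (n / d) : ℝ) ≤ 1 + Real.log n := by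
  refine le_trans ?_ (harmonic_le_one_add_log n)
  simp only [harmonic_eq_sum_Icc]
  push_cast
  exact Finset.sum_le_sum_of_subset_of_nonneg
    (Finset.Icc_subset_Icc_right (Nat.div_le_self n d)) fun i _ _ => by positivity

theorem tendsto_harmonic_natDiv_div_log {d : ℕ} (hd : d ≠ 0) :
    Tendsto (fun n : ℕ => (harmonic (n / d) : ℝ) / Real.log n) atTop (nhds 1) := by
  have hinv := tendsto_log_natCast_atTop.inv_tendsto_atTop
  have hlow : Tendsto (fun n : ℕ => 1 - Real.log d * (Real.log n)⁻¹) atTop (nhds 1) := by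
    simpa using tendsto_const_nhds.sub (hinv.const_mul (Real.log d))
  have hupp : Tendsto (fun n : ℕ => (Real.log n)⁻¹ + 1) atTop (nhds 1) := by
    simpa using hinv.add_const 1
  refine tendsto_of_tendsto_of_tendsto_of_le_of_le' hlow hupp ?_ ?_
  · filter_upwards [tendsto_log_natCast_atTop.eventually_gt_atTop 0, eventually_gt_atTop 0]
      with n hn hn0
    have h := log_le_harmonic_floor ((n : ℝ) / d) (by positivity)
    rw [Nat.floor_div_eq_div, Real.log_div (by positivity) (by positivity)] at h
    rw [le_div_iff₀ hn]
    field_simp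
    linarith
  · filter_upwards [tendsto_log_natCast_atTop.eventually_gt_atTop 0] with n hn
    rw [div_le_iff₀ hn]
    have := harmonic_natDiv_le n d
    field_simp
    linarith

/-- `∑_{e ≤ n} φ(e)/e² ∼ log n / ζ(2)`. -/
theorem tendsto_sum_totient_div_sq_div_log :
    Tendsto (fun n : ℕ => (∑ e ∈ Finset.Icc 1 n, (Nat.totient e : ℝ) / (e : ℝ) ^ 2) / Real.log n)
      atTop (nhds (1 / zetaReal 2)) := by
  have hsum := hasSum_moebius_div_pow (k := 2) (by norm_num)
  have key : Tendsto (fun n : ℕ => ∑' d : ℕ, (ArithmeticFunction.moebius d : ℝ) / (d : ℝ) ^ 2 *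
      ((harmonic (n / d) : ℝ) / Real.log n)) atTop
      (nhds (∑' d : ℕ, (ArithmeticFunction.moebius d : ℝ) / (d : ℝ) ^ 2)) := by
    refine tendsto_tsum_of_dominated_convergence (hsum.summable.norm.mul_right 2)
      (fun d => ?_) ?_
    · rcases eq_or_ne d 0 with rfl | hd
      · simp
      · simpa using (tendsto_harmonic_natDiv_div_log hd).const_mul
          ((ArithmeticFunction.moebius d : ℝ) / (d : ℝ) ^ 2)
    · filter_upwards [tendsto_log_natCast_atTop.eventually_ge_atTop 1] with n hn d
      rw [norm_mul]
      refine mul_le_mul_of_nonneg_left ?_ (norm_nonneg _)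
      have hpos : (0 : ℝ) ≤ harmonic (n / d) := by
        rw [harmonic]; push_cast; positivity
      rw [Real.norm_of_nonneg (by positivity), div_le_iff₀ (by positivity)]
      linarith [harmonic_natDiv_le n d]
  rw [hsum.tsum_eq, Nat.cast_ofNat] at key
  refine key.congr fun n => ?_
  rw [sum_totient_div_sq, Finset.sum_div, ← sum_Icc_one_eq_tsum (n := n) (by simp)
    fun e he => by simp [Nat.div_eq_of_lt he]]
  exact Finset.sum_congr rfl fun e _ => by ring

theorem mean_pillai_bounds (n : ℕ) :
    (∑ e ∈ Finset.Icc 1 n, (Nat.totient e : ℝ) / (e : ℝ) ^ 2) - 1 ≤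
        (1 / (n : ℝ)) * ∑ k ∈ Finset.Icc 1 n, (pillai k : ℝ) / (k : ℝ) ∧
      (1 / (n : ℝ)) * ∑ k ∈ Finset.Icc 1 n, (pillai k : ℝ) / (k : ℝ) ≤
        ∑ e ∈ Finset.Icc 1 n, (Nat.totient e : ℝ) / (e : ℝ) ^ 2 := by
  rcases Nat.eq_zero_or_pos n with rfl | hn
  · simp
  have hn' : (0 : ℝ) < n := by positivity
  have hP : ∑ k ∈ Finset.Icc 1 n, (pillai k : ℝ) / (k : ℝ) =
      ∑ e ∈ Finset.Icc 1 n, (Nat.totient e : ℝ) / (e : ℝ) * ((n / e : ℕ) : ℝ) := by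
    simpa [pillai, pillaiPow] using sum_pillaiPow_div_pow 1 n
  rw [hP, Finset.mul_sum]
  constructor
  · have h1 : (1 : ℝ) = ∑ e ∈ Finset.Icc 1 n, 1 / (n : ℝ) := by
      simp [hn'.ne']
    conv_lhs => rw [h1, ← Finset.sum_sub_distrib]
    refine Finset.sum_le_sum fun e he => ?_
    have he' : (0 : ℝ) < e := by exact_mod_cast (Finset.mem_Icc.1 he).1
    have hphi : (Nat.totient e : ℝ) / e ≤ 1 :=
      (div_le_one he').2 (by exact_mod_cast Nat.totient_le e)
    have hfl : (n : ℝ) / e - 1 ≤ ((n / e : ℕ) : ℝ) := by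
      rw [← Nat.floor_div_eq_div (K := ℝ)]
      exact (Nat.sub_one_lt_floor _).le
    have hmul := mul_le_mul_of_nonneg_left hfl (show 0 ≤ (Nat.totient e : ℝ) / e by positivity)
    calc (Nat.totient e : ℝ) / (e : ℝ) ^ 2 - 1 / n
        = 1 / (n : ℝ) * ((Nat.totient e : ℝ) / e * (n / e) - 1) := by field_simp
      _ ≤ 1 / (n : ℝ) * ((Nat.totient e : ℝ) / e * ((n / e : ℕ) : ℝ)) :=
        mul_le_mul_of_nonneg_left (by linarith) (by positivity)
  · refine Finset.sum_le_sum fun e he => ?_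
    calc 1 / (n : ℝ) * ((Nat.totient e : ℝ) / e * ((n / e : ℕ) : ℝ))
        = (Nat.totient e : ℝ) / e * (((n / e : ℕ) : ℝ) / n) := by ring
      _ ≤ (Nat.totient e : ℝ) / e * (1 / e) :=
        mul_le_mul_of_nonneg_left (natDiv_div_le n e) (by positivity)
      _ = _ := by ring

theorem tendsto_mean_pillai_div_log :
    Tendsto (fun n : ℕ =>
        ((1 / (n : ℝ)) * ∑ k ∈ Finset.Icc 1 n, (pillai k : ℝ) / (k : ℝ)) / Real.log n)
      atTop (nhds (1 / zetaReal 2)) := by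
  have hinv := tendsto_log_natCast_atTop.inv_tendsto_atTop
  have hlow : Tendsto (fun n : ℕ =>
      ((∑ e ∈ Finset.Icc 1 n, (Nat.totient e : ℝ) / (e : ℝ) ^ 2) - 1) / Real.log n)
      atTop (nhds (1 / zetaReal 2)) := by
    simpa [sub_div] using tendsto_sum_totient_div_sq_div_log.sub hinv
  refine tendsto_of_tendsto_of_tendsto_of_le_of_le hlow tendsto_sum_totient_div_sq_div_log
    (fun n => ?_) (fun n => ?_)
  · exact div_le_div_of_nonneg_right (mean_pillai_bounds n).1 (Real.log_natCast_nonneg n)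
  · exact div_le_div_of_nonneg_right (mean_pillai_bounds n).2 (Real.log_natCast_nonneg n)

/-- (a) `(1/n) Σ_{k≤n} P(k)/k ∼ (1/ζ(2)) ln n` as `n → ∞`; (b) for each fixed integer `s ≥ 2`,
`(1/n) Σ_{k≤n} P_s(k)/k^s → ζ(s)/ζ(s+1)` as `n → ∞`. -/
theorem pillai_averages :
    Tendsto (fun n : ℕ =>
        ((1 / (n : ℝ)) * ∑ k ∈ Finset.Icc 1 n, (pillai k : ℝ) / (k : ℝ)) /
          ((1 / zetaReal 2) * Real.log n))
      atTop (nhds 1) ∧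
    ∀ s : ℕ, 2 ≤ s →
      Tendsto (fun n : ℕ =>
          (1 / (n : ℝ)) * ∑ k ∈ Finset.Icc 1 n, (pillaiPow s k : ℝ) / (k : ℝ) ^ s)
        atTop (nhds (zetaReal s / zetaReal ((s : ℝ) + 1))) := by
  refine ⟨?_, fun s hs => tendsto_mean_pillaiPow hs⟩
  have hz : 1 / zetaReal 2 ≠ 0 :=
    one_div_ne_zero (by exact_mod_cast zetaReal_natCast_ne_zero (k := 2) (by norm_num))
  have h := tendsto_mean_pillai_div_log.div_const (1 / zetaReal 2)
  rw [div_self hz] at h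
  refine h.congr fun n => ?_
  rw [div_div, mul_comm (Real.log n)]
end
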